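/- Let γ be the standard Gaussian measure on ℝⁿ and dν = e^f dγ a probability measure with f twice continuously differentiable, finite second moment, finite relative entropy, and γ-integrable Gaussian width D(ν) of K = {∇f(x) : x ∈ ℝⁿ}. Then ∫ |x|² dν − ∫ |x|² dγ ≤ 2 D_KL(ν||γ) + D(ν). -/

import Mathlib

open MeasureTheory Real
open scoped RealInnerProductSpace ENNReal

noncomputable def stdGaussian (n : ℕ) : Measure (EuclideanSpace ℝ (Fin n)) :=
  (volume : Measure (EuclideanSpace ℝ (Fin n))).withDensity
    fun x => ENNReal.ofReal ((2 * π) ^ (-(n : ℝ) / 2) * Real.exp (-‖x‖ ^ 2 / 2))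

noncomputable def lap {n : ℕ} (f : EuclideanSpace ℝ (Fin n) → ℝ)
    (x : EuclideanSpace ℝ (Fin n)) : ℝ :=
  ∑ i, fderiv ℝ (fun y => gradient f y) x (EuclideanSpace.single i 1) i

/-- `y ↦ sup_{t ∈ K} ⟨y, t⟩`. -/
noncomputable def gaussWidthFn {n : ℕ} (K : Set (EuclideanSpace ℝ (Fin n)))
    (y : EuclideanSpace ℝ (Fin n)) : ℝ :=
  ⨆ t : K, ⟪y, (t : EuclideanSpace ℝ (Fin n))⟫

def IsCoupling {n : ℕ}
    (p : Measure (EuclideanSpace ℝ (Fin n) × EuclideanSpace ℝ (Fin n)))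
    (ν γ : Measure (EuclideanSpace ℝ (Fin n))) : Prop :=
  p.map Prod.fst = ν ∧ p.map Prod.snd = γ

/-- Squared quadratic Wasserstein distance. -/
noncomputable def W2sq {n : ℕ} (ν γ : Measure (EuclideanSpace ℝ (Fin n))) : ℝ :=
  sInf {r : ℝ | ∃ p, IsCoupling p ν γ ∧ IsProbabilityMeasure p ∧
    r = ∫ q, ‖q.1 - q.2‖ ^ 2 ∂p}

section Gaussian

variable {n : ℕ}

local notation "E" => EuclideanSpace ℝ (Fin n)

noncomputable def gaussDensity (x : EuclideanSpace ℝ (Fin n)) : ℝ :=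
  (2 * π) ^ (-(n : ℝ) / 2) * Real.exp (-‖x‖ ^ 2 / 2)

lemma gaussDensity_pos (x : E) : 0 < gaussDensity x := by
  unfold gaussDensity; positivity

lemma continuous_gaussDensity : Continuous (gaussDensity : E → ℝ) := by
  unfold gaussDensity; fun_prop

lemma stdGaussian_eq_withDensity : stdGaussian n =
    (volume : Measure (EuclideanSpace ℝ (Fin n))).withDensity
      fun x => ENNReal.ofReal (gaussDensity x) := rfl

lemma hasFDerivAt_gaussDensity (x : E) :
    HasFDerivAt (gaussDensity : E → ℝ) (-gaussDensity x • innerSL ℝ x) x := by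
  have h := ((((hasStrictFDerivAt_norm_sq x).hasFDerivAt.const_mul (-(1 / 2 : ℝ))).exp).const_mul
    ((2 * π) ^ (-(n : ℝ) / 2)))
  have e : (fun y : E => (2 * π) ^ (-(n : ℝ) / 2) * Real.exp (-(1 / 2) * ‖y‖ ^ 2))
      = gaussDensity := by
    funext y; unfold gaussDensity; congr 2; ring
  rw [e] at h
  refine h.congr_fderiv ?_
  ext u
  simp only [gaussDensity, smul_apply, innerSL_apply_apply, smul_eq_mul,
    neg_smul, neg_apply, nsmul_eq_mul]
  rw [show -(1 / 2) * ‖x‖ ^ 2 = -‖x‖ ^ 2 / 2 by ring]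
  push_cast
  ring

variable {Y : Type*} [NormedAddCommGroup Y] [NormedSpace ℝ Y]

lemma integral_stdGaussian (F : EuclideanSpace ℝ (Fin n) → Y) :
    ∫ x, F x ∂(stdGaussian n) = ∫ x, gaussDensity x • F x := by
  rw [stdGaussian_eq_withDensity, integral_withDensity_eq_integral_toReal_smul
    (continuous_gaussDensity.measurable.ennreal_ofReal) (by simp)]
  refine integral_congr_ae (Filter.Eventually.of_forall fun x => ?_)
  simp only
  rw [ENNReal.toReal_ofReal (gaussDensity_pos x).le]

lemma integrable_stdGaussian_iff (F : EuclideanSpace ℝ (Fin n) → Y) :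
    Integrable F (stdGaussian n) ↔ Integrable fun x => gaussDensity x • F x := by
  rw [stdGaussian_eq_withDensity, integrable_withDensity_iff_integrable_smul'
    (continuous_gaussDensity.measurable.ennreal_ofReal) (by simp)]
  refine integrable_congr (Filter.Eventually.of_forall fun x => ?_)
  simp only
  rw [ENNReal.toReal_ofReal (gaussDensity_pos x).le]

lemma integrable_exp_neg_mul_sq_norm {b : ℝ} (hb : 0 < b) :
    Integrable fun x : EuclideanSpace ℝ (Fin n) => Real.exp (-b * ‖x‖ ^ 2) := by
  have h := (GaussianFourier.integrable_cexp_neg_mul_sq_norm_add (V := E) (b := (b : ℂ))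
    (by simpa using hb) 0 0).norm
  refine h.congr (Filter.Eventually.of_forall fun x => ?_)
  simp only [Complex.norm_exp]
  congr 1
  rw [← Complex.ofReal_re (-b * ‖x‖ ^ 2)]
  push_cast
  simp

lemma integrable_exp_norm_stdGaussian (c : ℝ) :
    Integrable (fun x => Real.exp (c * ‖x‖)) (stdGaussian n) := by
  rw [integrable_stdGaussian_iff]
  refine Integrable.mono'
    ((integrable_exp_neg_mul_sq_norm (n := n) (b := 1 / 4) (by norm_num)).const_mul
      ((2 * π) ^ (-(n : ℝ) / 2) * Real.exp (c ^ 2)))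
    ((continuous_gaussDensity.smul (by fun_prop)).aestronglyMeasurable)
    (Filter.Eventually.of_forall fun x => ?_)
  rw [Real.norm_of_nonneg (smul_nonneg (gaussDensity_pos x).le (Real.exp_pos _).le)]
  unfold gaussDensity
  rw [smul_eq_mul, mul_assoc, mul_assoc, ← Real.exp_add, ← Real.exp_add]
  gcongr _ * Real.exp ?_
  nlinarith [sq_nonneg (‖x‖ / 2 - c)]

instance : IsProbabilityMeasure (stdGaussian n) := by
  have hi : Integrable (fun _ : E => (1 : ℝ)) (stdGaussian n) := by
    simpa using integrable_exp_norm_stdGaussian (n := n) 0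
  have hfin : IsFiniteMeasure (stdGaussian n) :=
    ((integrable_const_iff (c := (1 : ℝ))).1 hi).resolve_left one_ne_zero
  have h1 : ∫ _, (1 : ℝ) ∂(stdGaussian n) = 1 := by
    rw [integral_stdGaussian]
    have e : ∀ x : E, gaussDensity x • (1 : ℝ)
        = (2 * π) ^ (-(n : ℝ) / 2) * Real.exp (-(1 / 2) * ‖x‖ ^ 2) := by
      intro x; unfold gaussDensity; rw [smul_eq_mul, mul_one]; congr 2; ring
    simp_rw [e]
    rw [integral_const_mul, GaussianFourier.integral_rexp_neg_mul_sq_norm (by norm_num),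
      finrank_euclideanSpace_fin, show π / (1 / 2) = 2 * π by ring,
      ← Real.rpow_add (by positivity), neg_div, neg_add_cancel, Real.rpow_zero]
  constructor
  rw [integral_const, smul_eq_mul, mul_one] at h1
  rw [← ENNReal.ofReal_toReal (measure_ne_top (stdGaussian n) Set.univ)]
  rw [Measure.real] at h1
  rw [h1, ENNReal.ofReal_one]

lemma charFun_standardGaussian (t : EuclideanSpace ℝ (Fin n)) :
    charFun (stdGaussian n) t = Complex.exp (-((‖t‖ : ℂ) ^ 2 / 2)) := by
  rw [charFun_apply, integral_stdGaussian]
  have e : ∀ x : E, gaussDensity x • Complex.exp (⟪x, t⟫ * Complex.I)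
      = (((2 * π) ^ (-(n : ℝ) / 2) : ℝ) : ℂ)
        * Complex.exp (-(1 / 2 : ℂ) * ‖x‖ ^ 2 + Complex.I * ⟪t, x⟫) := by
    intro x
    unfold gaussDensity
    rw [Complex.real_smul, Complex.ofReal_mul, mul_assoc, Complex.ofReal_exp, ← Complex.exp_add,
      real_inner_comm]
    congr 2
    push_cast
    ring
  simp_rw [e]
  rw [integral_const_mul, GaussianFourier.integral_cexp_neg_mul_sq_norm_add (by norm_num),
    finrank_euclideanSpace_fin, ← mul_assoc]
  have : (((2 * π) ^ (-(n : ℝ) / 2) : ℝ) : ℂ) * ((π : ℂ) / (1 / 2)) ^ ((n : ℂ) / 2) = 1 := by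
    rw [Complex.ofReal_cpow (by positivity)]
    push_cast
    rw [show (π : ℂ) / (1 / 2) = 2 * π by ring, ← Complex.cpow_add _ _ (by simp [Real.pi_ne_zero]),
      neg_div, neg_add_cancel, Complex.cpow_zero]
  rw [this, one_mul, Complex.I_sq]
  congr 1
  ring

/-- Stability of the centred Gaussian law under independent sums. -/
lemma map_stdGaussian_prod {a b c : ℝ} (h : a ^ 2 + b ^ 2 = c ^ 2) :
    ((stdGaussian n).prod (stdGaussian n)).map (fun p => a • p.1 + b • p.2)
      = (stdGaussian n).map (c • ·) := by
  have : ((stdGaussian n).prod (stdGaussian n)).map (fun p => a • p.1 + b • p.2)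
      = (((stdGaussian n).map (a • ·)).prod ((stdGaussian n).map (b • ·))).map
        (fun p => p.1 + p.2) := by
    rw [Measure.map_prod_map _ _ (by fun_prop) (by fun_prop),
      Measure.map_map (by fun_prop) (by fun_prop)]
    rfl
  have pa : IsProbabilityMeasure ((stdGaussian n).map (a • ·)) :=
    Measure.isProbabilityMeasure_map (by fun_prop)
  have pb : IsProbabilityMeasure ((stdGaussian n).map (b • ·)) :=
    Measure.isProbabilityMeasure_map (by fun_prop)
  rw [this]
  refine Measure.ext_of_charFun ?_
  rw [ProbabilityTheory.charFun_map_add_prod_eq_mul]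
  ext t
  rw [Pi.mul_apply, charFun_map_smul, charFun_map_smul, charFun_map_smul,
    charFun_standardGaussian, charFun_standardGaussian, charFun_standardGaussian,
    ← Complex.exp_add]
  congr 1
  simp only [norm_smul, Complex.ofReal_mul, mul_pow, ← Complex.ofReal_pow, Real.norm_eq_abs,
    sq_abs, ← h]
  push_cast
  ring

end Gaussian

section ExpBounded

variable {X X' Y Z : Type*} [NormedAddCommGroup X] [MeasurableSpace X]
  [NormedAddCommGroup X'] [MeasurableSpace X']
  [NormedAddCommGroup Y] [NormedAddCommGroup Z]

/-- Strongly measurable functions of at most exponential growth. -/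
def ExpBounded (F : X → Y) : Prop :=
  StronglyMeasurable F ∧ ∃ K c : ℝ, 0 ≤ K ∧ 0 ≤ c ∧ ∀ x, ‖F x‖ ≤ K * Real.exp (c * ‖x‖)

namespace ExpBounded

lemma const (y : Y) : ExpBounded (fun _ : X => y) :=
  ⟨stronglyMeasurable_const, ‖y‖, 0, norm_nonneg _, le_rfl, fun x => by simp⟩

lemma of_norm_le {F : X → Y} {G : X → Z} (hG : ExpBounded G) (hF : StronglyMeasurable F)
    (h : ∀ x, ‖F x‖ ≤ ‖G x‖) : ExpBounded F := by
  obtain ⟨-, K, c, hK, hc, hb⟩ := hG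
  exact ⟨hF, K, c, hK, hc, fun x => (h x).trans (hb x)⟩

lemma add {F G : X → Y} (hF : ExpBounded F) (hG : ExpBounded G) :
    ExpBounded (fun x => F x + G x) := by
  obtain ⟨mF, K, c, hK, hc, hb⟩ := hF
  obtain ⟨mG, K', c', hK', hc', hb'⟩ := hG
  refine ⟨mF.add mG, K + K', c + c', by positivity, by positivity, fun x => ?_⟩
  refine (norm_add_le _ _).trans ?_
  rw [add_mul]
  have hx := norm_nonneg x
  refine add_le_add ((hb x).trans ?_) ((hb' x).trans ?_)
  · gcongr; linarith
  · gcongr; linarith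

lemma neg {F : X → Y} (hF : ExpBounded F) : ExpBounded (fun x => -F x) :=
  hF.of_norm_le hF.1.neg fun x => by rw [norm_neg]

lemma sub {F G : X → Y} (hF : ExpBounded F) (hG : ExpBounded G) :
    ExpBounded (fun x => F x - G x) := by
  simpa only [sub_eq_add_neg] using hF.add hG.neg

lemma norm {F : X → Y} (hF : ExpBounded F) : ExpBounded (fun x => ‖F x‖) :=
  hF.of_norm_le hF.1.norm fun x => by rw [norm_norm]

lemma mul {F G : X → ℝ} (hF : ExpBounded F) (hG : ExpBounded G) :
    ExpBounded (fun x => F x * G x) := by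
  obtain ⟨mF, K, c, hK, hc, hb⟩ := hF
  obtain ⟨mG, K', c', hK', hc', hb'⟩ := hG
  refine ⟨mF.mul mG, K * K', c + c', by positivity, by positivity, fun x => ?_⟩
  rw [norm_mul, add_mul, Real.exp_add, mul_mul_mul_comm]
  exact mul_le_mul (hb x) (hb' x) (norm_nonneg _) (by positivity)

lemma pow {F : X → ℝ} (hF : ExpBounded F) (k : ℕ) : ExpBounded (fun x => F x ^ k) := by
  induction k with
  | zero => simpa using const (X := X) (1 : ℝ)
  | succ k ih => simpa only [pow_succ] using ih.mul hF

lemma smul [NormedSpace ℝ Y] {F : X → ℝ} {G : X → Y} (hF : ExpBounded F) (hG : ExpBounded G) :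
    ExpBounded (fun x => F x • G x) :=
  (hF.norm.mul hG.norm).of_norm_le (hF.1.smul hG.1) fun x => by
    rw [norm_smul, norm_mul, norm_norm, norm_norm]

lemma inner {V : Type*} [NormedAddCommGroup V] [InnerProductSpace ℝ V] {F G : X → V}
    (hF : ExpBounded F) (hG : ExpBounded G) : ExpBounded (fun x => ⟪F x, G x⟫) :=
  (hF.norm.mul hG.norm).of_norm_le (hF.1.inner hG.1) fun x => by
    rw [norm_mul, norm_norm, norm_norm]; exact norm_inner_le_norm _ _

/-- Composition with a map of at most linear growth. -/
lemma comp {F : X' → Y} (hF : ExpBounded F) {φ : X → X'} (hφ : Measurable φ) {a b : ℝ}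
    (ha : 0 ≤ a) (h : ∀ x, ‖φ x‖ ≤ a * ‖x‖ + b) : ExpBounded (fun x => F (φ x)) := by
  obtain ⟨mF, K, c, hK, hc, hb⟩ := hF
  refine ⟨mF.comp_measurable hφ, K * Real.exp (c * b), c * a, by positivity, by positivity,
    fun x => (hb _).trans ?_⟩
  rw [mul_assoc, ← Real.exp_add]
  gcongr
  nlinarith [h x]

lemma exp_of_le {F : X → ℝ} (hF : StronglyMeasurable F) {a b : ℝ} (ha : 0 ≤ a)
    (h : ∀ x, F x ≤ a * ‖x‖ + b) : ExpBounded (fun x => Real.exp (F x)) := by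
  refine ⟨Real.continuous_exp.comp_stronglyMeasurable hF, Real.exp b, a, by positivity, ha,
    fun x => ?_⟩
  rw [Real.norm_of_nonneg (Real.exp_pos _).le, ← Real.exp_add]
  gcongr
  linarith [h x]

lemma of_linear_growth {F : X → Y} (hF : StronglyMeasurable F) {a b : ℝ} (ha : 0 ≤ a)
    (hb : 0 ≤ b) (h : ∀ x, ‖F x‖ ≤ a * ‖x‖ + b) : ExpBounded F := by
  refine ⟨hF, a + b, 1, by positivity, zero_le_one, fun x => (h x).trans ?_⟩
  have h1 := Real.add_one_le_exp (1 * ‖x‖)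
  have h0 := norm_nonneg x
  nlinarith [mul_nonneg hb h0]

lemma clm [NormedSpace ℝ Y] {V : Type*} [NormedAddCommGroup V] [NormedSpace ℝ V] [MeasurableSpace V]
    [OpensMeasurableSpace V] [SecondCountableTopologyEither V Y] (L : V →L[ℝ] Y) :
    ExpBounded (fun x => L x) :=
  of_linear_growth L.continuous.stronglyMeasurable (norm_nonneg L) le_rfl
    fun x => by simpa using L.le_opNorm x

lemma id' {V : Type*} [NormedAddCommGroup V] [NormedSpace ℝ V] [MeasurableSpace V]
    [OpensMeasurableSpace V] [SecondCountableTopology V] : ExpBounded (fun x : V => x) :=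
  clm (ContinuousLinearMap.id ℝ V)

end ExpBounded

end ExpBounded

section Integrals

lemma exp_norm_prod_le {V W : Type*} [NormedAddCommGroup V] [NormedAddCommGroup W]
    {c : ℝ} (hc : 0 ≤ c) (x : V) (y : W) :
    Real.exp (c * ‖(x, y)‖) ≤ Real.exp (c * ‖x‖) * Real.exp (c * ‖y‖) := by
  rw [← Real.exp_add, ← mul_add]
  gcongr
  exact max_le (by simp) (by simp)

variable {n : ℕ} {X Y : Type*} [NormedAddCommGroup X] [MeasurableSpace X]
  [NormedAddCommGroup Y]

local notation "E" => EuclideanSpace ℝ (Fin n)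

lemma ExpBounded.integrable {F : EuclideanSpace ℝ (Fin n) → Y} (hF : ExpBounded F) :
    Integrable F (stdGaussian n) := by
  obtain ⟨mF, K, c, hK, hc, hb⟩ := hF
  exact ((integrable_exp_norm_stdGaussian c).const_mul K).mono' mF.aestronglyMeasurable
    (Filter.Eventually.of_forall hb)

lemma ExpBounded.integrable_prod {F : EuclideanSpace ℝ (Fin n) × EuclideanSpace ℝ (Fin n) → Y}
    (hF : ExpBounded F) : Integrable F ((stdGaussian n).prod (stdGaussian n)) := by
  obtain ⟨mF, K, c, hK, hc, hb⟩ := hF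
  refine (((integrable_exp_norm_stdGaussian c).mul_prod
    (integrable_exp_norm_stdGaussian c)).const_mul K).mono' mF.aestronglyMeasurable
    (Filter.Eventually.of_forall fun p => (hb p).trans ?_)
  gcongr
  exact exp_norm_prod_le hc p.1 p.2

lemma ExpBounded.comp_affine {F : EuclideanSpace ℝ (Fin n) → Y} (hF : ExpBounded F) (x : E)
    (c : ℝ) : ExpBounded (fun y => F (x + c • y)) :=
  hF.comp (by fun_prop) (abs_nonneg c) (b := ‖x‖) fun y => by
    refine (norm_add_le _ _).trans ?_
    rw [norm_smul, Real.norm_eq_abs, add_comm]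

lemma norm_add_smul_add_smul_le (x : E) (a b : ℝ) (p : E × E) :
    ‖x + a • p.1 + b • p.2‖ ≤ (|a| + |b|) * ‖p‖ + ‖x‖ := by
  have h1 : ‖p.1‖ ≤ ‖p‖ := norm_fst_le p
  have h2 : ‖p.2‖ ≤ ‖p‖ := norm_snd_le p
  calc ‖x + a • p.1 + b • p.2‖ ≤ ‖x‖ + ‖a • p.1‖ + ‖b • p.2‖ := norm_add₃_le
    _ = ‖x‖ + |a| * ‖p.1‖ + |b| * ‖p.2‖ := by simp only [norm_smul, Real.norm_eq_abs]
    _ ≤ ‖x‖ + |a| * ‖p‖ + |b| * ‖p‖ := by gcongr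
    _ = _ := by ring

lemma ExpBounded.comp_affine₂ {F : EuclideanSpace ℝ (Fin n) → Y} (hF : ExpBounded F) (x : E)
    (a b : ℝ) : ExpBounded (fun p : E × E => F (x + a • p.1 + b • p.2)) :=
  hF.comp (by fun_prop) (by positivity) (norm_add_smul_add_smul_le x a b)

variable [NormedSpace ℝ Y]

lemma ExpBounded.integral {F : X × EuclideanSpace ℝ (Fin n) → Y} (hF : ExpBounded F) :
    ExpBounded (fun x => ∫ y, F (x, y) ∂(stdGaussian n)) := by
  obtain ⟨mF, K, c, hK, hc, hb⟩ := hF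
  refine ⟨mF.integral_prod_right', K * ∫ y, Real.exp (c * ‖y‖) ∂(stdGaussian n), c,
    mul_nonneg hK (integral_nonneg fun _ => (Real.exp_pos _).le), hc, fun x => ?_⟩
  rw [mul_right_comm, ← integral_const_mul]
  refine norm_integral_le_of_norm_le ((integrable_exp_norm_stdGaussian c).const_mul _)
    (Filter.Eventually.of_forall fun y => (hb _).trans ?_)
  rw [mul_assoc]
  gcongr
  exact exp_norm_prod_le hc x y

/-- Semigroup property of Gaussian averages. -/
lemma integral_integral_stdGaussian {F : EuclideanSpace ℝ (Fin n) → Y} (hF : ExpBounded F)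
    {a b c : ℝ} (h : a ^ 2 + b ^ 2 = c ^ 2) :
    ∫ y, ∫ y', F (a • y + b • y') ∂(stdGaussian n) ∂(stdGaussian n)
      = ∫ y, F (c • y) ∂(stdGaussian n) := by
  have hI : Integrable (fun p : E × E => F (a • p.1 + b • p.2))
      ((stdGaussian n).prod (stdGaussian n)) := by
    simpa using (hF.comp_affine₂ 0 a b).integrable_prod
  rw [integral_integral hI, ← integral_map (φ := (c • · : E → E)) (by fun_prop) hF.1.aestronglyMeasurable,
    ← integral_map (φ := fun p : E × E => a • p.1 + b • p.2) (by fun_prop)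
      hF.1.aestronglyMeasurable, map_stdGaussian_prod h]

/-- Gaussian integration by parts. -/
lemma integral_inner_mul_stdGaussian {φ : EuclideanSpace ℝ (Fin n) → ℝ}
    (hd : Differentiable ℝ φ) (hφ : ExpBounded φ) (u : E)
    (hφ' : ExpBounded fun y => fderiv ℝ φ y u) :
    ∫ y, ⟪y, u⟫ * φ y ∂(stdGaussian n) = ∫ y, fderiv ℝ φ y u ∂(stdGaussian n) := by
  have hρ : ∀ x : E, fderiv ℝ gaussDensity x u = -(gaussDensity x * ⟪x, u⟫) := fun x => by
    rw [(hasFDerivAt_gaussDensity x).fderiv]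
    simp
  have hI := (integrable_stdGaussian_iff _).1 hφ.integrable
  have hI' := (integrable_stdGaussian_iff _).1 hφ'.integrable
  have hI2 := (integrable_stdGaussian_iff _).1 ((ExpBounded.id'.inner (.const u)).mul hφ).integrable
  simp only [smul_eq_mul] at hI hI' hI2
  have key := integral_mul_fderiv_eq_neg_fderiv_mul_of_integrable
    (μ := (volume : Measure E)) (f := φ) (g := gaussDensity) (v := u)
    (by simpa only [mul_comm] using hI')
    (by
      refine hI2.neg.congr (Filter.Eventually.of_forall fun x => ?_)
      simp only [Pi.neg_apply, hρ]; ring)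
    (by simpa only [mul_comm] using hI)
    (fun x _ => hd x) (fun x _ => (hasFDerivAt_gaussDensity x).differentiableAt)
  rw [integral_stdGaussian, integral_stdGaussian]
  simp only [hρ, smul_eq_mul] at key ⊢
  rw [← neg_inj, ← integral_neg]
  calc _ = ∫ x, φ x * -(gaussDensity x * ⟪x, u⟫) := by
        congr 1; funext x; ring
    _ = _ := by
        rw [key]; congr 2; funext x; ring

/-- The Cameron-Martin formula. -/
lemma integral_comp_add_stdGaussian (F : EuclideanSpace ℝ (Fin n) → Y) (v : E) :
    ∫ y, F (y + v) ∂(stdGaussian n)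
      = ∫ y, Real.exp (⟪y, v⟫ - ‖v‖ ^ 2 / 2) • F y ∂(stdGaussian n) := by
  rw [integral_stdGaussian, integral_stdGaussian,
    ← integral_add_right_eq_self (fun y => gaussDensity y • _ • F y) v]
  congr 1
  funext y
  rw [smul_smul]
  congr 1
  unfold gaussDensity
  rw [mul_assoc, ← Real.exp_add, norm_add_sq_real, inner_add_left, real_inner_self_eq_norm_sq]
  congr 2
  ring

end Integrals

section TiltEstimate

variable {n : ℕ}

local notation "E" => EuclideanSpace ℝ (Fin n)

lemma integral_inner_stdGaussian (u : EuclideanSpace ℝ (Fin n)) :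
    ∫ y, ⟪y, u⟫ ∂(stdGaussian n) = 0 := by
  have h := integral_inner_mul_stdGaussian (φ := fun _ : E => (1 : ℝ)) (by fun_prop) (.const _) u
    (by simpa using ExpBounded.const (0 : ℝ))
  simpa using h

lemma integral_inner_mul_inner_stdGaussian (u v : EuclideanSpace ℝ (Fin n)) :
    ∫ y, ⟪y, u⟫ * ⟪v, y⟫ ∂(stdGaussian n) = ⟪v, u⟫ := by
  have hd : ∀ y : E, fderiv ℝ (fun y : E => ⟪v, y⟫) y = innerSL ℝ v :=
    fun y => (innerSL ℝ v).hasFDerivAt.fderiv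
  have h := integral_inner_mul_stdGaussian (φ := fun y : E => ⟪v, y⟫)
    (innerSL ℝ v).differentiable
    (ExpBounded.clm (innerSL ℝ v)) u (by simpa [hd] using ExpBounded.const (X := E) (⟪v, u⟫))
  simpa [hd] using h

lemma abs_exp_sub_one_sub_le (t : ℝ) : |Real.exp t - 1 - t| ≤ t ^ 2 * Real.exp |t| := by
  have h := Complex.norm_exp_sub_sum_le_norm_mul_exp (t : ℂ) 2
  rw [← Real.norm_eq_abs, ← Complex.norm_real]
  simpa [Finset.sum_range_succ, sub_sub] using h

lemma abs_exp_inner_sub_one_sub_le {V : Type*} [NormedAddCommGroup V] [InnerProductSpace ℝ V]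
    {y v : V} {a C : ℝ} (ha : 0 < a) (ha1 : a ≤ 1) (hv : ‖v‖ ≤ C) :
    |Real.exp (⟪a • y, v⟫ - ‖a • v‖ ^ 2 / 2) - 1 - ⟪a • y, v⟫|
      ≤ a ^ 2 * ((C * ‖y‖ + C ^ 2) ^ 2 * Real.exp (C * ‖y‖ + C ^ 2) + C ^ 2) := by
  have hny := norm_nonneg y
  have hC : 0 ≤ C := (norm_nonneg v).trans hv
  have hav : ‖a • v‖ ^ 2 / 2 ≤ a ^ 2 * C ^ 2 := by
    rw [norm_smul, Real.norm_of_nonneg ha.le, mul_pow]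
    have h1 : ‖v‖ ^ 2 ≤ C ^ 2 := by gcongr
    have h2 : a ^ 2 * ‖v‖ ^ 2 ≤ a ^ 2 * C ^ 2 := by gcongr
    have h3 : 0 ≤ a ^ 2 * ‖v‖ ^ 2 := by positivity
    linarith
  have hav0 : 0 ≤ ‖a • v‖ ^ 2 / 2 := by positivity
  generalize ‖a • v‖ ^ 2 / 2 = s at hav hav0
  have hiv : |⟪a • y, v⟫| ≤ a * (C * ‖y‖) := by
    refine (abs_real_inner_le_norm _ _).trans ?_
    rw [norm_smul, Real.norm_of_nonneg ha.le, mul_assoc, mul_comm C]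
    gcongr
  generalize ⟪a • y, v⟫ = q at hiv
  have htb : |q - s| ≤ a * (C * ‖y‖ + C ^ 2) := by
    refine (abs_sub _ _).trans ?_
    rw [abs_of_nonneg hav0]
    have : a ^ 2 * C ^ 2 ≤ a * C ^ 2 := by
      gcongr
      exact pow_le_of_le_one ha.le ha1 two_ne_zero
    linarith
  have h0 : 0 ≤ C * ‖y‖ + C ^ 2 := by positivity
  have htb1 : |q - s| ≤ C * ‖y‖ + C ^ 2 := htb.trans (mul_le_of_le_one_left h0 ha1)
  have e1 := abs_exp_sub_one_sub_le (q - s)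
  have e2 : (q - s) ^ 2 ≤ (a * (C * ‖y‖ + C ^ 2)) ^ 2 := by
    rw [← sq_abs (q - s)]; gcongr
  have e3 : (q - s) ^ 2 * Real.exp |q - s|
      ≤ (a * (C * ‖y‖ + C ^ 2)) ^ 2 * Real.exp (C * ‖y‖ + C ^ 2) := by gcongr
  have e4 : Real.exp (q - s) - 1 - q = (Real.exp (q - s) - 1 - (q - s)) + -s := by ring
  rw [e4]
  refine (abs_add_le _ _).trans ?_
  rw [abs_neg, abs_of_nonneg hav0]
  calc _ ≤ (a * (C * ‖y‖ + C ^ 2)) ^ 2 * Real.exp (C * ‖y‖ + C ^ 2) + a ^ 2 * C ^ 2 :=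
        add_le_add (e1.trans e3) hav
    _ = _ := by ring

lemma abs_sub_tilt_mul_norm_le {V : Type*} [NormedAddCommGroup V] [InnerProductSpace ℝ V]
    {y p v : V} {a C r κ S T G : ℝ} (ha : 0 < a) (ha1 : a ≤ 1) (hv : ‖v‖ ≤ C)
    (hκ0 : 0 < κ) (hκS : κ ≤ 1 + S) (hκ1 : |κ - 1| ≤ a ^ 2 * S) (hp : ‖κ • v - p‖ ≤ a * T)
    (hr : |r - 1 - ⟪p, a • y⟫| ≤ a ^ 2 * G) :
    |r - κ * Real.exp (⟪a • y, v⟫ - ‖a • v‖ ^ 2 / 2)| * ‖a • y - a ^ 2 • v‖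
      ≤ a ^ 3 * ((G + S + T * ‖y‖ + (1 + S) *
        ((C * ‖y‖ + C ^ 2) ^ 2 * Real.exp (C * ‖y‖ + C ^ 2) + C ^ 2)) * (‖y‖ + C)) := by
  have h1 := abs_exp_inner_sub_one_sub_le (y := y) ha ha1 hv
  have h2 : |⟪κ • v - p, a • y⟫| ≤ a ^ 2 * (T * ‖y‖) := by
    refine (abs_real_inner_le_norm _ _).trans ?_
    rw [norm_smul, Real.norm_of_nonneg ha.le]
    calc ‖κ • v - p‖ * (a * ‖y‖) ≤ (a * T) * (a * ‖y‖) := by gcongr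
      _ = _ := by ring
  generalize (C * ‖y‖ + C ^ 2) ^ 2 * Real.exp (C * ‖y‖ + C ^ 2) + C ^ 2 = Q at h1 ⊢
  generalize Real.exp (⟪a • y, v⟫ - ‖a • v‖ ^ 2 / 2) = ρ at h1 ⊢
  have h4 : |κ * (ρ - 1 - ⟪a • y, v⟫)| ≤ (1 + S) * (a ^ 2 * Q) := by
    rw [abs_mul, abs_of_pos hκ0]
    exact mul_le_mul hκS h1 (abs_nonneg _) (hκ0.le.trans hκS)
  have h3 : |r - κ * ρ| ≤ a ^ 2 * (G + S + T * ‖y‖ + (1 + S) * Q) := by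
    have dec : r - κ * ρ = (r - 1 - ⟪p, a • y⟫)
        + -(κ - 1) + -⟪κ • v - p, a • y⟫ + -(κ * (ρ - 1 - ⟪a • y, v⟫)) := by
      rw [inner_sub_left, real_inner_smul_left, real_inner_comm v (a • y)]
      ring
    rw [dec]
    have t1 := abs_add_le (r - 1 - ⟪p, a • y⟫ + -(κ - 1) + -⟪κ • v - p, a • y⟫)
      (-(κ * (ρ - 1 - ⟪a • y, v⟫)))
    have t2 := abs_add_le (r - 1 - ⟪p, a • y⟫ + -(κ - 1)) (-⟪κ • v - p, a • y⟫)
    have t3 := abs_add_le (r - 1 - ⟪p, a • y⟫) (-(κ - 1))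
    rw [abs_neg] at t1 t2 t3
    linarith
  have h5 : ‖a • y - a ^ 2 • v‖ ≤ a * (‖y‖ + C) := by
    refine (norm_sub_le _ _).trans ?_
    rw [norm_smul, norm_smul, Real.norm_of_nonneg ha.le, Real.norm_of_nonneg (by positivity),
      mul_add]
    gcongr
    exact pow_le_of_le_one ha.le ha1 two_ne_zero
  calc _ ≤ (a ^ 2 * (G + S + T * ‖y‖ + (1 + S) * Q)) * (a * (‖y‖ + C)) :=
        mul_le_mul h3 h5 (norm_nonneg _) ((abs_nonneg _).trans h3)
    _ = _ := by ring

lemma ExpBounded.exp_norm {B : ℝ} (hB : 0 ≤ B) (c : ℝ) :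
    ExpBounded (fun y : EuclideanSpace ℝ (Fin n) => Real.exp (B * ‖y‖ + c)) :=
  .exp_of_le (Continuous.stronglyMeasurable (by fun_prop)) hB fun _ => le_rfl

lemma expBounded_norm_pow_mul_exp {B : ℝ} (hB : 0 ≤ B) (k : ℕ) :
    ExpBounded (fun y : EuclideanSpace ℝ (Fin n) => ‖y‖ ^ k * Real.exp (B * ‖y‖)) := by
  simpa using (ExpBounded.id'.norm.pow k).mul (ExpBounded.exp_norm (n := n) hB 0)

section Expansion

variable {A B a κ : ℝ} {r : EuclideanSpace ℝ (Fin n) → ℝ} {p v : EuclideanSpace ℝ (Fin n)}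

lemma abs_expansion_smul_le (hA : 0 ≤ A) (hB : 0 ≤ B) (ha : 0 < a) (ha1 : a ≤ 1)
    (hexp : ∀ z, |r z - 1 - ⟪p, z⟫| ≤ A * ‖z‖ ^ 2 * Real.exp (B * ‖z‖)) (y : E) :
    |r (a • y) - 1 - ⟪p, a • y⟫| ≤ a ^ 2 * (A * (‖y‖ ^ 2 * Real.exp (B * ‖y‖))) := by
  refine (hexp _).trans ?_
  rw [norm_smul, Real.norm_of_nonneg ha.le]
  have : Real.exp (B * (a * ‖y‖)) ≤ Real.exp (B * ‖y‖) := by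
    gcongr
    exact mul_le_of_le_one_left (norm_nonneg y) ha1
  calc A * (a * ‖y‖) ^ 2 * Real.exp (B * (a * ‖y‖))
      ≤ A * (a * ‖y‖) ^ 2 * Real.exp (B * ‖y‖) := by gcongr
    _ = _ := by ring

lemma expBounded_inner_smul (p : E) (a : ℝ) : ExpBounded (fun y : E => ⟪p, a • y⟫) :=
  (ExpBounded.const p).inner (ExpBounded.clm (a • ContinuousLinearMap.id ℝ E))

lemma abs_integral_sub_one_le (hB : 0 ≤ B) (hr : ExpBounded fun y => r (a • y))
    (he : ∀ y, |r (a • y) - 1 - ⟪p, a • y⟫| ≤ a ^ 2 * (A * (‖y‖ ^ 2 * Real.exp (B * ‖y‖)))) :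
    |(∫ y, r (a • y) ∂(stdGaussian n)) - 1|
      ≤ a ^ 2 * (A * ∫ y : E, ‖y‖ ^ 2 * Real.exp (B * ‖y‖) ∂(stdGaussian n)) := by
  have : (∫ y, r (a • y) ∂(stdGaussian n)) - 1
      = ∫ y, (r (a • y) - 1 - ⟪p, a • y⟫) ∂(stdGaussian n) := by
    rw [integral_sub (hr.sub (.const _)).integrable (expBounded_inner_smul p a).integrable,
      integral_sub hr.integrable (ExpBounded.const _).integrable]
    simp_rw [inner_smul_right, integral_const_mul, real_inner_comm _ p,
      integral_inner_stdGaussian]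
    simp
  rw [this, ← integral_const_mul, ← integral_const_mul, ← Real.norm_eq_abs]
  exact norm_integral_le_of_norm_le
    (((expBounded_norm_pow_mul_exp hB 2).integrable.const_mul A).const_mul (a ^ 2))
    (Filter.Eventually.of_forall he)

lemma norm_mean_sub_le (hA : 0 ≤ A) (hB : 0 ≤ B) (ha : 0 < a)
    (hr : ExpBounded fun y => r (a • y))
    (he : ∀ y, |r (a • y) - 1 - ⟪p, a • y⟫| ≤ a ^ 2 * (A * (‖y‖ ^ 2 * Real.exp (B * ‖y‖))))
    (hmean : ∀ u, ∫ y, ⟪y, u⟫ * r (a • y) ∂(stdGaussian n) = a * κ * ⟪v, u⟫) :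
    ‖κ • v - p‖
      ≤ a * (A * ∫ y : E, ‖y‖ ^ 3 * Real.exp (B * ‖y‖) ∂(stdGaussian n)) := by
  have hI : 0 ≤ ∫ y : E, ‖y‖ ^ 3 * Real.exp (B * ‖y‖) ∂(stdGaussian n) :=
    integral_nonneg fun y => by positivity
  have key : ∀ u : E, a * ⟪κ • v - p, u⟫
      ≤ a ^ 2 * A * ‖u‖ * ∫ y : E, ‖y‖ ^ 3 * Real.exp (B * ‖y‖) ∂(stdGaussian n) := fun u => by
    have ti : ExpBounded (fun y : E => ⟪y, u⟫) := ExpBounded.id'.inner (.const u)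
    have tp := expBounded_inner_smul p a
    have : a * ⟪κ • v - p, u⟫
        = ∫ y, ⟪y, u⟫ * (r (a • y) - 1 - ⟪p, a • y⟫) ∂(stdGaussian n) := by
      simp_rw [mul_sub, mul_one]
      rw [integral_sub ((ti.mul hr).sub ti).integrable (ti.mul tp).integrable,
        integral_sub (ti.mul hr).integrable ti.integrable, hmean, integral_inner_stdGaussian]
      simp_rw [inner_smul_right, mul_left_comm _ a, integral_const_mul,
        integral_inner_mul_inner_stdGaussian]
      rw [inner_sub_left, real_inner_smul_left]
      ring
    rw [this, ← integral_const_mul]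
    refine (Real.le_norm_self _).trans (norm_integral_le_of_norm_le
      ((expBounded_norm_pow_mul_exp hB 3).integrable.const_mul _)
      (Filter.Eventually.of_forall fun y => ?_))
    rw [norm_mul]
    calc ‖⟪y, u⟫‖ * ‖r (a • y) - 1 - ⟪p, a • y⟫‖
        ≤ (‖y‖ * ‖u‖) * (a ^ 2 * (A * (‖y‖ ^ 2 * Real.exp (B * ‖y‖)))) :=
          mul_le_mul (norm_inner_le_norm _ _) (he y) (norm_nonneg _) (by positivity)
      _ = _ := by ring
  have h1 := key (κ • v - p)
  rw [real_inner_self_eq_norm_sq] at h1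
  generalize (∫ y : E, ‖y‖ ^ 3 * Real.exp (B * ‖y‖) ∂(stdGaussian n)) = I at hI h1 ⊢
  rcases (norm_nonneg (κ • v - p)).eq_or_lt with h0 | h0
  · rw [← h0]; positivity
  · refine le_of_mul_le_mul_left (a := a * ‖κ • v - p‖) ?_ (by positivity)
    linarith

end Expansion

/-- If `r` is a positive density expanding to first order at the origin, then under a Gaussian law
of small covariance `a ^ 2` the normalised tilt by `r` is close to the translate having the same
mean. -/
lemma exists_tilt_estimate (n : ℕ) {A B m C : ℝ} (hA : 0 ≤ A) (hB : 0 ≤ B) (hm : 0 < m)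
    (hC : 0 ≤ C) :
    ∃ D, 0 ≤ D ∧ ∀ a : ℝ, 0 < a → a ≤ 1 → ∀ (r : EuclideanSpace ℝ (Fin n) → ℝ)
      (p v : EuclideanSpace ℝ (Fin n)), ExpBounded r → ‖v‖ ≤ C →
      (∀ z, |r z - 1 - ⟪p, z⟫| ≤ A * ‖z‖ ^ 2 * Real.exp (B * ‖z‖)) →
      ∀ κ : ℝ, κ = ∫ y, r (a • y) ∂(stdGaussian n) → m ≤ κ →
      (∀ u, ∫ y, ⟪y, u⟫ * r (a • y) ∂(stdGaussian n) = a * κ * ⟪v, u⟫) →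
      ∫ y, |r (a • y) - κ * Real.exp (⟪a • y, v⟫ - ‖a • v‖ ^ 2 / 2)| * ‖a • y - a ^ 2 • v‖
        ∂(stdGaussian n) ≤ κ * (D * a ^ 3) := by
  obtain ⟨S, hS⟩ : ∃ S, S = A * ∫ y : EuclideanSpace ℝ (Fin n),
    ‖y‖ ^ 2 * Real.exp (B * ‖y‖) ∂(stdGaussian n) := ⟨_, rfl⟩
  obtain ⟨T, hT⟩ : ∃ T, T = A * ∫ y : EuclideanSpace ℝ (Fin n),
    ‖y‖ ^ 3 * Real.exp (B * ‖y‖) ∂(stdGaussian n) := ⟨_, rfl⟩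
  have hS0 : 0 ≤ S := hS ▸ mul_nonneg hA (integral_nonneg fun y => by positivity)
  have hT0 : 0 ≤ T := hT ▸ mul_nonneg hA (integral_nonneg fun y => by positivity)
  obtain ⟨J, hJ⟩ : ∃ J : EuclideanSpace ℝ (Fin n) → ℝ, ∀ y, J y =
    (A * (‖y‖ ^ 2 * Real.exp (B * ‖y‖)) + S + T * ‖y‖ + (1 + S) *
        ((C * ‖y‖ + C ^ 2) ^ 2 * Real.exp (C * ‖y‖ + C ^ 2) + C ^ 2)) * (‖y‖ + C) :=
    ⟨_, fun _ => rfl⟩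
  have hJ0 : ∀ y, 0 ≤ J y := fun y => by rw [hJ]; positivity
  have tn : ExpBounded (fun y : EuclideanSpace ℝ (Fin n) => ‖y‖) := ExpBounded.id'.norm
  have tJ : ExpBounded J := by
    rw [funext hJ]
    exact (((((ExpBounded.const A).mul (expBounded_norm_pow_mul_exp hB 2)).add (.const _)).add
      ((ExpBounded.const _).mul tn)).add ((ExpBounded.const _).mul
        (((((((ExpBounded.const C).mul tn).add (.const _)).pow 2).mul
          (ExpBounded.exp_norm hC _)).add (.const _))))).mul (tn.add (.const _))
  have hK0 : 0 ≤ ∫ y, J y ∂(stdGaussian n) := integral_nonneg hJ0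
  refine ⟨(∫ y, J y ∂(stdGaussian n)) / m, by positivity, ?_⟩
  intro a ha ha1 r p v hr hv hexp κ hκ hmκ hmean
  have hκ0 : 0 < κ := hm.trans_le hmκ
  have tra : ExpBounded (fun y : EuclideanSpace ℝ (Fin n) => r (a • y)) := by
    simpa using hr.comp_affine 0 a
  have he := abs_expansion_smul_le hA hB ha ha1 hexp
  have hκ1 : |κ - 1| ≤ a ^ 2 * S := by
    rw [hκ, hS]; exact abs_integral_sub_one_le hB tra he
  have hpv : ‖κ • v - p‖ ≤ a * T := by
    rw [hT]; exact norm_mean_sub_le hA hB ha tra he hmean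
  have hκ2 : κ ≤ 1 + S := by
    have h1 := (le_abs_self _).trans hκ1
    have h2 : a ^ 2 * S ≤ S :=
      mul_le_of_le_one_left hS0 (pow_le_one₀ ha.le ha1)
    linarith
  calc _ ≤ ∫ y, a ^ 3 * J y ∂(stdGaussian n) :=
        integral_mono_of_nonneg (Filter.Eventually.of_forall fun y => by positivity)
          (tJ.integrable.const_mul _) (Filter.Eventually.of_forall fun y => by
            beta_reduce
            rw [hJ]
            exact abs_sub_tilt_mul_norm_le ha ha1 hv hκ0 hκ2 hκ1 hpv (he y))
    _ = m * ((∫ y, J y ∂(stdGaussian n)) / m * a ^ 3) := by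
        rw [integral_const_mul]; field_simp
    _ ≤ _ := by gcongr

end TiltEstimate

section GaussAvg

variable {n : ℕ} {Y : Type*} [NormedAddCommGroup Y] [NormedSpace ℝ Y]

local notation "E" => EuclideanSpace ℝ (Fin n)

/-- The Gaussian average of `F` around `x` at scale `c`. -/
noncomputable def gaussAvg (F : EuclideanSpace ℝ (Fin n) → Y) (c : ℝ)
    (x : EuclideanSpace ℝ (Fin n)) : Y :=
  ∫ y, F (x + c • y) ∂(stdGaussian n)

lemma ExpBounded.gaussAvg {F : EuclideanSpace ℝ (Fin n) → Y} (hF : ExpBounded F) (c : ℝ) :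
    ExpBounded (gaussAvg F c) := by
  have h := hF.comp_affine₂ 0 1 c
  simp only [zero_add, one_smul] at h
  exact h.integral

lemma gaussAvg_gaussAvg {F : EuclideanSpace ℝ (Fin n) → Y} (hF : ExpBounded F) {a b c : ℝ}
    (h : a ^ 2 + b ^ 2 = c ^ 2) (x : E) :
    ∫ y, gaussAvg F b (x + a • y) ∂(stdGaussian n) = gaussAvg F c x := by
  have h1 := integral_integral_stdGaussian (hF.comp_affine x 1) h
  simp only [one_smul] at h1
  simp only [gaussAvg, ← h1, add_assoc]

end GaussAvg

section Potential

variable {n : ℕ}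

local notation "E" => EuclideanSpace ℝ (Fin n)

/-- A continuously differentiable potential `f` whose gradient `g` is bounded by `C`. -/
structure IsLipPotential (f : EuclideanSpace ℝ (Fin n) → ℝ)
    (g : EuclideanSpace ℝ (Fin n) → EuclideanSpace ℝ (Fin n)) (C : ℝ) : Prop where
  hasGradientAt : ∀ x, HasGradientAt f (g x) x
  continuous_grad : Continuous g
  norm_grad_le : ∀ x, ‖g x‖ ≤ C

variable {f : EuclideanSpace ℝ (Fin n) → ℝ}
  {g : EuclideanSpace ℝ (Fin n) → EuclideanSpace ℝ (Fin n)} {C : ℝ}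

/-- The Gaussian evolution of the density `exp f`. -/
noncomputable def heat (f : EuclideanSpace ℝ (Fin n) → ℝ) : ℝ → EuclideanSpace ℝ (Fin n) → ℝ :=
  gaussAvg fun x => Real.exp (f x)

/-- The Gaussian evolution of the gradient of `exp f`. -/
noncomputable def heatGrad (f : EuclideanSpace ℝ (Fin n) → ℝ)
    (g : EuclideanSpace ℝ (Fin n) → EuclideanSpace ℝ (Fin n)) :
    ℝ → EuclideanSpace ℝ (Fin n) → EuclideanSpace ℝ (Fin n) :=
  gaussAvg fun x => Real.exp (f x) • g x

namespace IsLipPotential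

lemma nonneg (hf : IsLipPotential f g C) : 0 ≤ C := (norm_nonneg _).trans (hf.norm_grad_le 0)

lemma differentiable (hf : IsLipPotential f g C) : Differentiable ℝ f :=
  fun x => (hf.hasGradientAt x).differentiableAt

lemma abs_sub_le (hf : IsLipPotential f g C) (x y : E) : |f x - f y| ≤ C * ‖x - y‖ := by
  have h := Convex.norm_image_sub_le_of_norm_hasFDerivWithin_le (s := Set.univ) (C := C) (f := f)
    (fun z _ => (hf.hasGradientAt z).hasFDerivAt.hasFDerivWithinAt)
    (fun z _ => by simpa using hf.norm_grad_le z) convex_univ (Set.mem_univ y) (Set.mem_univ x)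
  simpa using h

lemma apply_add_smul_le (hf : IsLipPotential f g C) {b : ℝ} (hb : 0 ≤ b) (hb1 : b ≤ 1) (x y : E) :
    f (x + b • y) ≤ f x + C * ‖y‖ := by
  have h := (le_abs_self _).trans (hf.abs_sub_le (x + b • y) x)
  rw [add_sub_cancel_left, norm_smul, Real.norm_of_nonneg hb] at h
  have : C * (b * ‖y‖) ≤ C * ‖y‖ :=
    mul_le_mul_of_nonneg_left (mul_le_of_le_one_left (norm_nonneg y) hb1) hf.nonneg
  linarith

lemma le_apply_add_smul (hf : IsLipPotential f g C) {b : ℝ} (hb : 0 ≤ b) (hb1 : b ≤ 1) (x y : E) :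
    f x - C * ‖y‖ ≤ f (x + b • y) := by
  have h := (neg_le_abs _).trans (hf.abs_sub_le (x + b • y) x)
  rw [add_sub_cancel_left, norm_smul, Real.norm_of_nonneg hb] at h
  have : C * (b * ‖y‖) ≤ C * ‖y‖ :=
    mul_le_mul_of_nonneg_left (mul_le_of_le_one_left (norm_nonneg y) hb1) hf.nonneg
  linarith

lemma expBounded (hf : IsLipPotential f g C) : ExpBounded f :=
  .of_linear_growth hf.differentiable.continuous.stronglyMeasurable hf.nonneg (abs_nonneg (f 0))
    fun x => by
      have h := hf.abs_sub_le x 0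
      rw [sub_zero] at h
      have := abs_add_le (f x - f 0) (f 0)
      rw [sub_add_cancel] at this
      rw [Real.norm_eq_abs]
      linarith

lemma expBounded_exp (hf : IsLipPotential f g C) : ExpBounded fun x => Real.exp (f x) :=
  .exp_of_le hf.expBounded.1 hf.nonneg (b := f 0) fun x => by
    have := (le_abs_self _).trans (hf.abs_sub_le x 0)
    rw [sub_zero] at this
    linarith

lemma expBounded_grad (hf : IsLipPotential f g C) : ExpBounded g :=
  (ExpBounded.const C).of_norm_le hf.continuous_grad.stronglyMeasurable fun x =>
    (hf.norm_grad_le x).trans (le_abs_self C)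

lemma expBounded_exp_smul_grad (hf : IsLipPotential f g C) :
    ExpBounded fun x => Real.exp (f x) • g x :=
  hf.expBounded_exp.smul hf.expBounded_grad

lemma expBounded_heat (hf : IsLipPotential f g C) (b : ℝ) : ExpBounded (heat f b) :=
  hf.expBounded_exp.gaussAvg b

lemma expBounded_heatGrad (hf : IsLipPotential f g C) (b : ℝ) : ExpBounded (heatGrad f g b) :=
  hf.expBounded_exp_smul_grad.gaussAvg b

lemma le_heat (hf : IsLipPotential f g C) {b : ℝ} (hb : 0 ≤ b) (hb1 : b ≤ 1) (x : E) :
    (∫ y : E, Real.exp (-(C * ‖y‖)) ∂(stdGaussian n)) * Real.exp (f x) ≤ heat f b x := by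
  rw [mul_comm, ← integral_const_mul]
  refine integral_mono_of_nonneg (Filter.Eventually.of_forall fun y => by positivity)
    (hf.expBounded_exp.comp_affine x b).integrable (Filter.Eventually.of_forall fun y => ?_)
  beta_reduce
  rw [← Real.exp_add]
  gcongr
  linarith [hf.le_apply_add_smul hb hb1 x y]

lemma heat_pos (hf : IsLipPotential f g C) (b : ℝ) (x : E) : 0 < heat f b x :=
  integral_exp_pos (hf.expBounded_exp.comp_affine x b).integrable

lemma norm_heatGrad_le (hf : IsLipPotential f g C) (b : ℝ) (x : E) :
    ‖heatGrad f g b x‖ ≤ C * heat f b x := by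
  unfold heatGrad heat gaussAvg
  rw [← integral_const_mul]
  refine norm_integral_le_of_norm_le
    ((hf.expBounded_exp.comp_affine x b).integrable.const_mul C)
    (Filter.Eventually.of_forall fun y => ?_)
  rw [norm_smul, Real.norm_of_nonneg (Real.exp_pos _).le, mul_comm]
  gcongr
  exact hf.norm_grad_le _

lemma heat_add_le (hf : IsLipPotential f g C) (b : ℝ) (x z : E) :
    heat f b (x + z) ≤ Real.exp (C * ‖z‖) * heat f b x := by
  unfold heat gaussAvg
  rw [← integral_const_mul]
  refine integral_mono (hf.expBounded_exp.comp_affine (x + z) b).integrable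
    ((hf.expBounded_exp.comp_affine x b).integrable.const_mul _) fun y => ?_
  beta_reduce
  rw [← Real.exp_add]
  gcongr
  have h := (le_abs_self _).trans (hf.abs_sub_le (x + z + b • y) (x + b • y))
  rw [show x + z + b • y - (x + b • y) = z by abel] at h
  linarith

lemma heat_add_ge (hf : IsLipPotential f g C) (b : ℝ) (x z : E) :
    Real.exp (-(C * ‖z‖)) * heat f b x ≤ heat f b (x + z) := by
  have h := hf.heat_add_le b (x + z) (-z)
  rw [add_neg_cancel_right, norm_neg] at h
  calc _ ≤ Real.exp (-(C * ‖z‖)) * (Real.exp (C * ‖z‖) * heat f b (x + z)) := by gcongr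
    _ = _ := by rw [← mul_assoc, ← Real.exp_add]; simp

/-- Integration by parts against the Gaussian evolution of `exp f`. -/
lemma integral_inner_mul_heat (hf : IsLipPotential f g C) {a b c : ℝ} (h : a ^ 2 + b ^ 2 = c ^ 2)
    (x u : E) :
    ∫ y, ⟪y, u⟫ * heat f b (x + a • y) ∂(stdGaussian n) = a * ⟪heatGrad f g c x, u⟫ := by
  have hI : ExpBounded fun q : E × E => ⟪q.1, u⟫ * Real.exp (f (x + a • q.1 + b • q.2)) := by
    refine ((ExpBounded.id'.comp measurable_fst zero_le_one (b := 0) fun q => ?_).inner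
      (.const u)).mul (hf.expBounded_exp.comp_affine₂ x a b)
    simpa using norm_fst_le q
  have hG : ExpBounded fun z : E => a * ⟪Real.exp (f (x + z)) • g (x + z), u⟫ := by
    have := hf.expBounded_exp_smul_grad.comp_affine x 1
    simp only [one_smul] at this
    exact (ExpBounded.const a).mul (this.inner (.const u))
  calc _ = ∫ y, ∫ y', ⟪y, u⟫ * Real.exp (f (x + a • y + b • y')) ∂(stdGaussian n)
          ∂(stdGaussian n) := by
        simp only [heat, gaussAvg, integral_const_mul]
    _ = ∫ y', ∫ y, ⟪y, u⟫ * Real.exp (f (x + a • y + b • y')) ∂(stdGaussian n)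
          ∂(stdGaussian n) := integral_integral_swap hI.integrable_prod
    _ = ∫ y', ∫ y, a * ⟪Real.exp (f (x + (b • y' + a • y))) • g (x + (b • y' + a • y)), u⟫
          ∂(stdGaussian n) ∂(stdGaussian n) := by
        congr 1
        funext y'
        have hd : ∀ y, HasFDerivAt (fun y : E => Real.exp (f (x + a • y + b • y')))
            (Real.exp (f (x + a • y + b • y')) • ((InnerProductSpace.toDual ℝ E
              (g (x + a • y + b • y'))).comp (a • ContinuousLinearMap.id ℝ E))) y := fun y => by
          refine ((hf.hasGradientAt _).hasFDerivAt.comp y ?_).exp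
          exact (((hasFDerivAt_id y).const_smul a).const_add x).add_const _
        have hd' : ∀ y, fderiv ℝ (fun y : E => Real.exp (f (x + a • y + b • y'))) y u
            = a * ⟪Real.exp (f (x + (b • y' + a • y))) • g (x + (b • y' + a • y)), u⟫ :=
          fun y => by
            rw [(hd y).fderiv, ← add_assoc, add_right_comm x (b • y')]
            simp [inner_smul_left, mul_left_comm]
        rw [integral_inner_mul_stdGaussian (fun y => (hd y).differentiableAt)
          (by simpa only [add_right_comm] using hf.expBounded_exp.comp_affine (x + b • y') a) u
          (by
            simp only [hd']
            exact hG.comp_affine (b • y') a)]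
        simp only [hd']
    _ = ∫ y, a * ⟪Real.exp (f (x + c • y)) • g (x + c • y), u⟫ ∂(stdGaussian n) :=
        integral_integral_stdGaussian hG (by linarith)
    _ = _ := by
        rw [integral_const_mul, heatGrad, gaussAvg, real_inner_comm,
          ← integral_inner (hf.expBounded_exp_smul_grad.comp_affine x c).integrable]
        simp only [real_inner_comm u]

end IsLipPotential

end Potential

section Expansion

variable {n : ℕ}

local notation "E" => EuclideanSpace ℝ (Fin n)

variable {f : EuclideanSpace ℝ (Fin n) → ℝ}
  {g : EuclideanSpace ℝ (Fin n) → EuclideanSpace ℝ (Fin n)} {C : ℝ}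

/-- The relative gradient of the Gaussian evolution of `exp f`, as an average of displacements. -/
noncomputable def heatScore (f : EuclideanSpace ℝ (Fin n) → ℝ) (b : ℝ)
    (x : EuclideanSpace ℝ (Fin n)) : EuclideanSpace ℝ (Fin n) :=
  (b * heat f b x)⁻¹ • ∫ y, Real.exp (f (x + b • y)) • y ∂(stdGaussian n)

namespace IsLipPotential

/-- Weighted averages against `exp f` are controlled by the evolved density. -/
lemma integral_exp_mul_le (hf : IsLipPotential f g C) {b : ℝ} (hb : 0 ≤ b) (hb1 : b ≤ 1)
    {Q : EuclideanSpace ℝ (Fin n) → ℝ} (hQ : ExpBounded Q) (hQ0 : ∀ y, 0 ≤ Q y) (x : E) :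
    ∫ y, Real.exp (f (x + b • y)) * Q y ∂(stdGaussian n)
      ≤ (∫ y, Real.exp (C * ‖y‖) * Q y ∂(stdGaussian n))
        / (∫ y : E, Real.exp (-(C * ‖y‖)) ∂(stdGaussian n)) * heat f b x := by
  have hm : 0 < ∫ y : E, Real.exp (-(C * ‖y‖)) ∂(stdGaussian n) :=
    integral_exp_pos (by simpa using integrable_exp_norm_stdGaussian (n := n) (-C))
  have hI : 0 ≤ ∫ y, Real.exp (C * ‖y‖) * Q y ∂(stdGaussian n) :=
    integral_nonneg fun y => mul_nonneg (Real.exp_pos _).le (hQ0 y)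
  have te : ExpBounded fun y : E => Real.exp (C * ‖y‖) := by
    simpa using ExpBounded.exp_norm (n := n) hf.nonneg 0
  have h1 : ∫ y, Real.exp (f (x + b • y)) * Q y ∂(stdGaussian n)
      ≤ Real.exp (f x) * ∫ y, Real.exp (C * ‖y‖) * Q y ∂(stdGaussian n) := by
    rw [← integral_const_mul]
    refine integral_mono ((hf.expBounded_exp.comp_affine x b).mul hQ).integrable
      ((te.mul hQ).integrable.const_mul _) fun y => ?_
    beta_reduce
    rw [← mul_assoc, ← Real.exp_add]
    exact mul_le_mul_of_nonneg_right (Real.exp_le_exp.2 (hf.apply_add_smul_le hb hb1 x y)) (hQ0 y)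
  have h2 := hf.le_heat hb hb1 x
  refine h1.trans ?_
  rw [div_mul_eq_mul_div, le_div_iff₀ hm]
  calc _ = (∫ y, Real.exp (C * ‖y‖) * Q y ∂(stdGaussian n))
        * ((∫ y : E, Real.exp (-(C * ‖y‖)) ∂(stdGaussian n)) * Real.exp (f x)) := by ring
    _ ≤ _ := by gcongr

lemma inner_heatScore (hf : IsLipPotential f g C) {b : ℝ} (hb : 0 < b) (x z : E) :
    heat f b x * ⟪heatScore f b x, z⟫
      = ∫ y, Real.exp (f (x + b • y)) * ⟪y, b⁻¹ • z⟫ ∂(stdGaussian n) := by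
  have hI := ((hf.expBounded_exp.comp_affine x b).smul ExpBounded.id').integrable
  have hh := (hf.heat_pos b x).ne'
  simp only [inner_smul_right, mul_left_comm _ b⁻¹, integral_const_mul, heatScore,
    real_inner_comm z, ← integral_inner hI]
  field_simp

lemma heat_add_eq (f : E → ℝ) {b : ℝ} (hb : 0 < b) (x z : E) :
    heat f b (x + z) = ∫ y, Real.exp (f (x + b • y))
      * Real.exp (⟪y, b⁻¹ • z⟫ - ‖b⁻¹ • z‖ ^ 2 / 2) ∂(stdGaussian n) := by
  have h := integral_comp_add_stdGaussian (fun y : E => Real.exp (f (x + b • y))) (b⁻¹ • z)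
  simp only [smul_add, smul_inv_smul₀ hb.ne', smul_eq_mul] at h
  simp only [mul_comm (Real.exp (f _)), ← h, heat, gaussAvg]
  congr 1
  funext y
  congr 2
  abel

lemma exists_heat_expansion_near (n : ℕ) {β : ℝ} (C : ℝ) (hβ : 0 < β) :
    ∃ A, 0 ≤ A ∧ ∀ (f : EuclideanSpace ℝ (Fin n) → ℝ) (g), IsLipPotential f g C → ∀ b, β ≤ b →
      b ≤ 1 → ∀ x z, ‖z‖ ≤ 1 →
        |heat f b (x + z) - heat f b x - heat f b x * ⟪heatScore f b x, z⟫|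
          ≤ A * ‖z‖ ^ 2 * heat f b x := by
  obtain ⟨Q, hQ⟩ : ∃ Q : EuclideanSpace ℝ (Fin n) → ℝ, ∀ y, Q y =
    (1 / β * ‖y‖ + (1 / β) ^ 2) ^ 2 * Real.exp (1 / β * ‖y‖ + (1 / β) ^ 2) + (1 / β) ^ 2 :=
    ⟨_, fun _ => rfl⟩
  have hQ0 : ∀ y, 0 ≤ Q y := fun y => by rw [hQ]; positivity
  have tQ : ExpBounded Q := by
    rw [funext hQ]
    exact (((((ExpBounded.const _).mul ExpBounded.id'.norm).add (.const _)).pow 2).mul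
      (ExpBounded.exp_norm (by positivity) _)).add (.const _)
  refine ⟨(∫ y, Real.exp (C * ‖y‖) * Q y ∂(stdGaussian n))
        / (∫ y : EuclideanSpace ℝ (Fin n), Real.exp (-(C * ‖y‖)) ∂(stdGaussian n)),
    div_nonneg (integral_nonneg fun y => mul_nonneg (Real.exp_pos _).le (hQ0 y))
      (integral_nonneg fun y => (Real.exp_pos _).le), fun f g hf b hb hb1 x z hz => ?_⟩
  have hb0 : 0 < b := hβ.trans_le hb
  rcases eq_or_ne z 0 with rfl | hz0
  · simp
  have hzp : 0 < ‖z‖ := norm_pos_iff.2 hz0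
  have tE := hf.expBounded_exp.comp_affine x b
  have tI : ExpBounded fun y : EuclideanSpace ℝ (Fin n) => ⟪y, b⁻¹ • z⟫ :=
    ExpBounded.id'.inner (.const _)
  have tR : ExpBounded fun y : EuclideanSpace ℝ (Fin n) =>
      Real.exp (⟪y, b⁻¹ • z⟫ - ‖b⁻¹ • z‖ ^ 2 / 2) :=
    .exp_of_le (tI.sub (.const _)).1 (norm_nonneg (b⁻¹ • z)) (b := 0) fun y => by
      have := real_inner_le_norm y (b⁻¹ • z)
      have : 0 ≤ ‖b⁻¹ • z‖ ^ 2 / 2 := by positivity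
      linarith
  have e : heat f b (x + z) - heat f b x - heat f b x * ⟪heatScore f b x, z⟫
      = ∫ y, Real.exp (f (x + b • y)) * (Real.exp (⟪y, b⁻¹ • z⟫ - ‖b⁻¹ • z‖ ^ 2 / 2)
        - 1 - ⟪y, b⁻¹ • z⟫) ∂(stdGaussian n) := by
    simp only [mul_sub, mul_one]
    rw [integral_sub ((tE.mul tR).sub tE).integrable (tE.mul tI).integrable,
      integral_sub (tE.mul tR).integrable tE.integrable, ← heat_add_eq f hb0,
      ← hf.inner_heatScore hb0]
    rfl
  have hpt : ∀ y : EuclideanSpace ℝ (Fin n),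
      |Real.exp (⟪y, b⁻¹ • z⟫ - ‖b⁻¹ • z‖ ^ 2 / 2) - 1 - ⟪y, b⁻¹ • z⟫| ≤ ‖z‖ ^ 2 * Q y :=
    fun y => by
      have hv : ‖(‖z‖⁻¹ * b⁻¹) • z‖ ≤ 1 / β := by
        rw [norm_smul, Real.norm_of_nonneg (by positivity), mul_right_comm,
          inv_mul_cancel₀ hzp.ne', one_mul, one_div]
        gcongr
      have hvz : ‖z‖ • ((‖z‖⁻¹ * b⁻¹) • z) = b⁻¹ • z := by
        rw [smul_smul, mul_inv_cancel_left₀ hzp.ne']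
      have h := abs_exp_inner_sub_one_sub_le (y := y) hzp hz hv
      rw [hQ]
      rwa [real_inner_smul_left, ← real_inner_smul_right, hvz] at h
  rw [e]
  calc _ ≤ ∫ y, ‖z‖ ^ 2 * (Real.exp (f (x + b • y)) * Q y) ∂(stdGaussian n) := by
        rw [← Real.norm_eq_abs]
        refine norm_integral_le_of_norm_le ((tE.mul tQ).integrable.const_mul _)
          (Filter.Eventually.of_forall fun y => ?_)
        rw [norm_mul, Real.norm_of_nonneg (Real.exp_pos _).le, mul_left_comm]
        gcongr
        exact hpt y
    _ ≤ _ := by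
        rw [integral_const_mul, mul_comm _ (‖z‖ ^ 2), mul_assoc]
        gcongr
        exact hf.integral_exp_mul_le hb0.le hb1 tQ hQ0 x

lemma exists_norm_heatScore_le (n : ℕ) {β : ℝ} (C : ℝ) (hβ : 0 < β) :
    ∃ P, 0 ≤ P ∧ ∀ (f : EuclideanSpace ℝ (Fin n) → ℝ) (g), IsLipPotential f g C → ∀ b, β ≤ b →
      b ≤ 1 → ∀ x, ‖heatScore f b x‖ ≤ P := by
  have hP : 0 ≤ (∫ y : EuclideanSpace ℝ (Fin n), Real.exp (C * ‖y‖) * ‖y‖ ∂(stdGaussian n))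
        / (∫ y : EuclideanSpace ℝ (Fin n), Real.exp (-(C * ‖y‖)) ∂(stdGaussian n)) :=
    div_nonneg (integral_nonneg fun y => by positivity)
      (integral_nonneg fun y => (Real.exp_pos _).le)
  refine ⟨β⁻¹ * ((∫ y : EuclideanSpace ℝ (Fin n), Real.exp (C * ‖y‖) * ‖y‖ ∂(stdGaussian n))
        / (∫ y : EuclideanSpace ℝ (Fin n), Real.exp (-(C * ‖y‖)) ∂(stdGaussian n))),
    by positivity, fun f g hf b hb hb1 x => ?_⟩
  have hb0 : 0 < b := hβ.trans_le hb
  have hh := hf.heat_pos b x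
  have h1 := hf.integral_exp_mul_le hb0.le hb1 ExpBounded.id'.norm (fun y => norm_nonneg y) x
  have h2 : ‖∫ y, Real.exp (f (x + b • y)) • y ∂(stdGaussian n)‖
      ≤ ∫ y, Real.exp (f (x + b • y)) * ‖y‖ ∂(stdGaussian n) :=
    norm_integral_le_of_norm_le
      ((hf.expBounded_exp.comp_affine x b).mul ExpBounded.id'.norm).integrable
      (Filter.Eventually.of_forall fun y => by
        rw [norm_smul, Real.norm_of_nonneg (Real.exp_pos _).le])
  generalize (∫ y : EuclideanSpace ℝ (Fin n), Real.exp (C * ‖y‖) * ‖y‖ ∂(stdGaussian n))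
        / (∫ y : EuclideanSpace ℝ (Fin n), Real.exp (-(C * ‖y‖)) ∂(stdGaussian n)) = P at hP h1 ⊢
  rw [heatScore, norm_smul, Real.norm_of_nonneg (by positivity)]
  calc _ ≤ (b * heat f b x)⁻¹ * (P * heat f b x) := by gcongr; exact h2.trans h1
    _ = b⁻¹ * P := by field_simp
    _ ≤ _ := by gcongr

/-- The Gaussian evolution of `exp f` expands to first order, uniformly in the base point and in
scales bounded away from zero. -/
lemma exists_heat_expansion (n : ℕ) {β : ℝ} (C : ℝ) (hβ : 0 < β) :
    ∃ A, 0 ≤ A ∧ ∀ (f : EuclideanSpace ℝ (Fin n) → ℝ) (g), IsLipPotential f g C → ∀ b, β ≤ b →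
      b ≤ 1 → ∀ x z,
        |heat f b (x + z) / heat f b x - 1 - ⟪heatScore f b x, z⟫|
          ≤ A * ‖z‖ ^ 2 * Real.exp (C * ‖z‖) := by
  obtain ⟨A, hA, hA'⟩ := exists_heat_expansion_near n C hβ
  obtain ⟨P, hP, hP'⟩ := exists_norm_heatScore_le n C hβ
  refine ⟨A + 2 + P, by positivity, fun f g hf b hb hb1 x z => ?_⟩
  have hh := hf.heat_pos b x
  have hC := hf.nonneg
  have he : 1 ≤ Real.exp (C * ‖z‖) := Real.one_le_exp (by positivity)
  rcases le_total ‖z‖ 1 with hz | hz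
  · have h := hA' f g hf b hb hb1 x z hz
    have e : heat f b (x + z) / heat f b x - 1 - ⟪heatScore f b x, z⟫
        = (heat f b (x + z) - heat f b x - heat f b x * ⟪heatScore f b x, z⟫) / heat f b x := by
      field_simp
    rw [e, abs_div, abs_of_pos hh, div_le_iff₀ hh]
    refine h.trans ?_
    refine mul_le_mul_of_nonneg_right ?_ hh.le
    calc A * ‖z‖ ^ 2 ≤ (A + 2 + P) * ‖z‖ ^ 2 * 1 := by rw [mul_one]; gcongr; linarith
      _ ≤ _ := by gcongr
  · have h1 : heat f b (x + z) / heat f b x ≤ Real.exp (C * ‖z‖) :=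
      (div_le_iff₀ hh).2 (hf.heat_add_le b x z)
    have h0 : 0 < heat f b (x + z) / heat f b x := div_pos (hf.heat_pos b _) hh
    have h2 : |⟪heatScore f b x, z⟫| ≤ P * ‖z‖ :=
      (abs_real_inner_le_norm _ _).trans (by gcongr; exact hP' f g hf b hb hb1 x)
    have hz2 : ‖z‖ ≤ ‖z‖ ^ 2 := by nlinarith
    have hz1 : 1 ≤ ‖z‖ ^ 2 := hz.trans hz2
    calc _ ≤ Real.exp (C * ‖z‖) + Real.exp (C * ‖z‖) + P * ‖z‖ := by
          have h3 := abs_le.1 h2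
          rw [abs_le]
          constructor <;> linarith [h3.1, h3.2]
      _ ≤ 2 * 1 * Real.exp (C * ‖z‖) + P * ‖z‖ ^ 2 * 1 := by
          have : P * ‖z‖ ≤ P * ‖z‖ ^ 2 := by gcongr
          linarith
      _ ≤ 2 * ‖z‖ ^ 2 * Real.exp (C * ‖z‖) + P * ‖z‖ ^ 2 * Real.exp (C * ‖z‖) := by gcongr
      _ ≤ _ := by
          have : 0 ≤ A * ‖z‖ ^ 2 * Real.exp (C * ‖z‖) := by positivity
          linarith

end IsLipPotential

end Expansion

section Recursion

variable {n : ℕ}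

local notation "E" => EuclideanSpace ℝ (Fin n)

lemma ExpBounded.of_abs_sub_le {w : EuclideanSpace ℝ (Fin n) → ℝ} {C : ℝ} (hC : 0 ≤ C)
    (hw : ∀ a b, |w a - w b| ≤ C * ‖a - b‖) : ExpBounded w := by
  have hc : Continuous w :=
    (LipschitzWith.of_dist_le_mul (K := ⟨C, hC⟩) fun a b => by
      rw [Real.dist_eq, dist_eq_norm]; exact hw a b).continuous
  refine .of_linear_growth hc.stronglyMeasurable hC (abs_nonneg (w 0)) fun x => ?_
  have h := hw x 0
  rw [sub_zero] at h
  have := abs_add_le (w x - w 0) (w 0)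
  rw [sub_add_cancel] at this
  rw [Real.norm_eq_abs]
  linarith

lemma abs_gaussAvg_sub_le {w : EuclideanSpace ℝ (Fin n) → ℝ} {C : ℝ} (hC : 0 ≤ C)
    (hw : ∀ a b, |w a - w b| ≤ C * ‖a - b‖) (c : ℝ) (a b : E) :
    |gaussAvg w c a - gaussAvg w c b| ≤ C * ‖a - b‖ := by
  have tw := ExpBounded.of_abs_sub_le hC hw
  have h : ‖∫ y, (w (a + c • y) - w (b + c • y)) ∂(stdGaussian n)‖
      ≤ ∫ y : E, C * ‖a - b‖ ∂(stdGaussian n) :=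
    norm_integral_le_of_norm_le (integrable_const _) (Filter.Eventually.of_forall fun y => by
      simpa using hw (a + c • y) (b + c • y))
  rw [integral_sub (tw.comp_affine a c).integrable (tw.comp_affine b c).integrable] at h
  simpa [gaussAvg] using h

lemma mul_log_add_sub_le {a b : ℝ} (ha : 0 < a) (hb : 0 < b) :
    a * Real.log b + a - b ≤ a * Real.log a := by
  have h := Real.log_le_sub_one_of_pos (div_pos hb ha)
  rw [Real.log_div hb.ne' ha.ne'] at h
  have h2 := mul_le_mul_of_nonneg_left h ha.le
  have : a * (b / a - 1) = b - a := by field_simp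
  linarith

lemma ExpBounded.mul_log {H : EuclideanSpace ℝ (Fin n) → ℝ} (hH : ExpBounded H)
    (h0 : ∀ y, 0 < H y) : ExpBounded fun y => H y * Real.log (H y) := by
  refine ((hH.pow 2).add (.const 1)).of_norm_le
    (hH.1.mul (Real.measurable_log.comp hH.1.measurable).stronglyMeasurable) fun y => ?_
  have h1 := mul_log_add_sub_le (h0 y) one_pos
  have h2 := mul_le_mul_of_nonneg_left (Real.log_le_self (h0 y).le) (h0 y).le
  rw [Real.log_one] at h1
  rw [Real.norm_eq_abs, Real.norm_of_nonneg (by positivity), abs_le]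
  have := h0 y
  constructor <;> nlinarith [sq_nonneg (H y)]

/-- The density of the translate by `u` of the standard Gaussian measure. -/
noncomputable def cameronMartin (u y : EuclideanSpace ℝ (Fin n)) : ℝ :=
  Real.exp (⟪y, u⟫ - ‖u‖ ^ 2 / 2)

lemma expBounded_cameronMartin (u : E) : ExpBounded (cameronMartin u) :=
  .exp_of_le ((ExpBounded.id'.inner (.const u)).sub (.const _)).1 (norm_nonneg u) (b := 0)
    fun y => by
      have := real_inner_le_norm y u
      have : 0 ≤ ‖u‖ ^ 2 / 2 := by positivity
      linarith

lemma integral_cameronMartin (u : E) : ∫ y, cameronMartin u y ∂(stdGaussian n) = 1 := by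
  have h := integral_comp_add_stdGaussian (fun _ : E => (1 : ℝ)) u
  simpa [cameronMartin] using h.symm

variable {f w : EuclideanSpace ℝ (Fin n) → ℝ}
  {g : EuclideanSpace ℝ (Fin n) → EuclideanSpace ℝ (Fin n)} {C : ℝ}

/-- The normalised gradient of the Gaussian evolution of `exp f`. -/
noncomputable def heatDrift (f : EuclideanSpace ℝ (Fin n) → ℝ)
    (g : EuclideanSpace ℝ (Fin n) → EuclideanSpace ℝ (Fin n)) (c : ℝ)
    (x : EuclideanSpace ℝ (Fin n)) : EuclideanSpace ℝ (Fin n) :=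
  (heat f c x)⁻¹ • heatGrad f g c x

/-- The estimate at scale `c`, with error `ε`, propagated along the Gaussian evolution. -/
def HeatBound (f : EuclideanSpace ℝ (Fin n) → ℝ)
    (g : EuclideanSpace ℝ (Fin n) → EuclideanSpace ℝ (Fin n))
    (w : EuclideanSpace ℝ (Fin n) → ℝ) (c ε : ℝ) : Prop :=
  ∀ x d, ⟪d, heatGrad f g c x⟫ + gaussAvg (fun z => Real.exp (f z) * (⟪z, g z⟫ - 2 * f z)) c x
    + 2 * (heat f c x * Real.log (heat f c x)) ≤ heat f c x * (gaussAvg w c (x + d) + ε)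

namespace IsLipPotential

lemma heat_smul_heatDrift (hf : IsLipPotential f g C) (c : ℝ) (x : E) :
    heat f c x • heatDrift f g c x = heatGrad f g c x :=
  smul_inv_smul₀ (hf.heat_pos c x).ne' _

lemma norm_heatDrift_le (hf : IsLipPotential f g C) (c : ℝ) (x : E) :
    ‖heatDrift f g c x‖ ≤ C := by
  have hh := hf.heat_pos c x
  rw [heatDrift, norm_smul, Real.norm_of_nonneg (by positivity), inv_mul_le_iff₀ hh, mul_comm]
  exact hf.norm_heatGrad_le c x

lemma integral_inner_mul_heat_eq (hf : IsLipPotential f g C) {a b c : ℝ}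
    (h : a ^ 2 + b ^ 2 = c ^ 2) (x u : E) :
    ∫ y, ⟪y, u⟫ * heat f b (x + a • y) ∂(stdGaussian n)
      = a * heat f c x * ⟪heatDrift f g c x, u⟫ := by
  rw [hf.integral_inner_mul_heat h, ← hf.heat_smul_heatDrift, real_inner_smul_left, mul_assoc]

/-- Relative entropy decreases along the Gaussian evolution by at least the energy of the
drift. -/
lemma heat_mul_log_add_le (hf : IsLipPotential f g C) {a b c : ℝ} (h : a ^ 2 + b ^ 2 = c ^ 2)
    (x : E) :
    heat f c x * Real.log (heat f c x) + a ^ 2 * heat f c x * ‖heatDrift f g c x‖ ^ 2 / 2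
      ≤ ∫ y, heat f b (x + a • y) * Real.log (heat f b (x + a • y)) ∂(stdGaussian n) := by
  have hh := hf.heat_pos c x
  have tH := (hf.expBounded_heat b).comp_affine x a
  have hH : ∫ y, heat f b (x + a • y) ∂(stdGaussian n) = heat f c x :=
    gaussAvg_gaussAvg hf.expBounded_exp h x
  have hm := hf.integral_inner_mul_heat_eq h x (heatDrift f g c x)
  rw [real_inner_self_eq_norm_sq] at hm
  generalize heatDrift f g c x = v at hm ⊢
  have tI : ExpBounded fun y : E => ⟪y, v⟫ := ExpBounded.id'.inner (.const v)
  have tρ := expBounded_cameronMartin (a • v)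
  have hpt : ∀ y : E, (Real.log (heat f c x) - ‖a • v‖ ^ 2 / 2 + 1) * heat f b (x + a • y)
      + a * (⟪y, v⟫ * heat f b (x + a • y)) - heat f c x * cameronMartin (a • v) y
      ≤ heat f b (x + a • y) * Real.log (heat f b (x + a • y)) := fun y => by
    have := mul_log_add_sub_le (hf.heat_pos b (x + a • y))
      (mul_pos hh (Real.exp_pos (⟪y, a • v⟫ - ‖a • v‖ ^ 2 / 2)))
    rw [Real.log_mul hh.ne' (Real.exp_pos _).ne', Real.log_exp] at this
    unfold cameronMartin
    rw [inner_smul_right] at this ⊢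
    linarith
  have key := integral_mono
    (((tH.integrable.const_mul _).add ((tI.mul tH).integrable.const_mul a)).sub
      (tρ.integrable.const_mul (heat f c x)))
    (tH.mul_log fun y => hf.heat_pos b _).integrable hpt
  rw [integral_sub' ((tH.integrable.const_mul _).add ((tI.mul tH).integrable.const_mul a))
    (tρ.integrable.const_mul _), integral_add' (tH.integrable.const_mul _)
    ((tI.mul tH).integrable.const_mul a), integral_const_mul, integral_const_mul,
    integral_const_mul, integral_cameronMartin, hm, hH, norm_smul, mul_pow, Real.norm_eq_abs,
    sq_abs] at key
  linarith

/-- The tilt estimate along the Gaussian evolution: moving by the drift is almost the same as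
sampling from the evolved density. -/
lemma exists_integral_heat_mul_le (n : ℕ) {β C : ℝ} (hβ : 0 < β) (hC : 0 ≤ C) :
    ∃ D, 0 ≤ D ∧ ∀ (f w : EuclideanSpace ℝ (Fin n) → ℝ) (g), IsLipPotential f g C →
      (∀ a b, |w a - w b| ≤ C * ‖a - b‖) → ∀ a b c, 0 < a → a ≤ 1 → β ≤ b → b ≤ 1 →
      a ^ 2 + b ^ 2 = c ^ 2 → ∀ x e,
      ∫ y, heat f b (x + a • y)
        * gaussAvg w b (e + (a • y - a ^ 2 • heatDrift f g c x)) ∂(stdGaussian n)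
        ≤ heat f c x * (gaussAvg w c e + D * a ^ 3) := by
  have hm : 0 < ∫ y : EuclideanSpace ℝ (Fin n), Real.exp (-(C * ‖y‖)) ∂(stdGaussian n) :=
    integral_exp_pos (by simpa using integrable_exp_norm_stdGaussian (n := n) (-C))
  obtain ⟨A, hA, hA'⟩ := exists_heat_expansion n C hβ
  obtain ⟨D, hD, hD'⟩ := exists_tilt_estimate n hA hC hm hC
  refine ⟨C * D, by positivity, fun f w g hf hw a b c ha ha1 hb hb1 h x e => ?_⟩
  have hb0 : 0 < heat f b x := hf.heat_pos b x
  have hc0 : 0 < heat f c x := hf.heat_pos c x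
  have tH := (hf.expBounded_heat b).comp_affine x a
  have hH : ∫ y, heat f b (x + a • y) ∂(stdGaussian n) = heat f c x :=
    gaussAvg_gaussAvg hf.expBounded_exp h x
  have hv := hf.norm_heatDrift_le c x
  have hmean := hf.integral_inner_mul_heat_eq h x
  generalize heatDrift f g c x = v at hv hmean ⊢
  have tw := ExpBounded.of_abs_sub_le hC hw
  have tW : ExpBounded fun y => gaussAvg w b (e + (a • y - a ^ 2 • v)) := by
    have := (tw.gaussAvg b).comp_affine (e - a ^ 2 • v) a
    refine cast ?_ this
    congr 1; funext y; congr 1; abel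
  have tρ := expBounded_cameronMartin (a • v)
  have tn : ExpBounded fun y : EuclideanSpace ℝ (Fin n) => ‖a • y - a ^ 2 • v‖ :=
    ((ExpBounded.clm (a • ContinuousLinearMap.id ℝ (EuclideanSpace ℝ (Fin n)))).sub
      (.const (a ^ 2 • v))).norm
  have est := hD' a ha ha1 (fun z => heat f b (x + z) / heat f b x) (heatScore f b x) v
    (by
      have := (hf.expBounded_heat b).comp_affine x 1
      simp only [one_smul] at this
      simpa only [div_eq_mul_inv] using this.mul (.const _))
    hv (hA' f g hf b hb hb1 x) (heat f c x / heat f b x) (by rw [integral_div, hH])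
    (by
      rw [le_div_iff₀ hb0, ← integral_mul_const, ← hH]
      refine integral_mono_of_nonneg (Filter.Eventually.of_forall fun y => by positivity)
        tH.integrable (Filter.Eventually.of_forall fun y =>
          le_trans ?_ (hf.heat_add_ge b x (a • y)))
      beta_reduce
      gcongr
      rw [norm_smul, Real.norm_of_nonneg ha.le]
      exact mul_le_of_le_one_left (norm_nonneg y) ha1)
    (fun u => by
      simp only [← mul_div_assoc, integral_div]
      rw [hmean]; ring)
  have htr : ∫ y, cameronMartin (a • v) y * gaussAvg w b (e + (a • y - a ^ 2 • v))
      ∂(stdGaussian n) = gaussAvg w c e := by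
    have := integral_comp_add_stdGaussian
      (fun y : EuclideanSpace ℝ (Fin n) => gaussAvg w b (e + (a • y - a ^ 2 • v))) (a • v)
    simp only [smul_eq_mul] at this
    rw [← gaussAvg_gaussAvg tw h e]
    refine Eq.trans this.symm ?_
    congr 1; funext y; congr 2
    rw [smul_add, smul_smul, ← sq, add_sub_cancel_right]
  have hρ1 := integral_cameronMartin (a • v)
  have hpt : ∀ y, heat f b (x + a • y) * gaussAvg w b (e + (a • y - a ^ 2 • v))
      ≤ heat f c x * (cameronMartin (a • v) y * gaussAvg w b (e + (a • y - a ^ 2 • v)))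
        + gaussAvg w b e * (heat f b (x + a • y) - heat f c x * cameronMartin (a • v) y)
        + C * heat f b x * (|heat f b (x + a • y) / heat f b x - heat f c x / heat f b x
          * cameronMartin (a • v) y| * ‖a • y - a ^ 2 • v‖) := fun y => by
    have h1 := abs_gaussAvg_sub_le hC hw b (e + (a • y - a ^ 2 • v)) e
    rw [add_sub_cancel_left] at h1
    have h2 : |heat f b (x + a • y) / heat f b x - heat f c x / heat f b x
          * cameronMartin (a • v) y| * heat f b x
        = |heat f b (x + a • y) - heat f c x * cameronMartin (a • v) y| := by
      rw [← abs_of_pos hb0, ← abs_mul, abs_of_pos hb0]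
      congr 1
      field_simp
    have h3 : C * heat f b x * (|heat f b (x + a • y) / heat f b x - heat f c x / heat f b x
          * cameronMartin (a • v) y| * ‖a • y - a ^ 2 • v‖)
        = |heat f b (x + a • y) - heat f c x * cameronMartin (a • v) y|
          * (C * ‖a • y - a ^ 2 • v‖) := by
      rw [← h2]; ring
    rw [h3]
    have h4 := mul_le_mul_of_nonneg_left h1
      (abs_nonneg (heat f b (x + a • y) - heat f c x * cameronMartin (a • v) y))
    rw [← abs_mul] at h4
    have h5 := (le_abs_self _).trans h4
    linarith
  have tabs : ExpBounded fun y => |heat f b (x + a • y) / heat f b x - heat f c x / heat f b x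
      * cameronMartin (a • v) y| * ‖a • y - a ^ 2 • v‖ := by
    refine ExpBounded.mul ?_ tn
    have := ((tH.mul (.const (heat f b x)⁻¹)).sub
      ((ExpBounded.const (heat f c x / heat f b x)).mul tρ)).norm
    simpa only [Real.norm_eq_abs, div_eq_mul_inv] using this
  have i1 := (tρ.mul tW).integrable.const_mul (heat f c x)
  have i2 := (tH.integrable.sub (tρ.integrable.const_mul (heat f c x))).const_mul (gaussAvg w b e)
  have i3 := tabs.integrable.const_mul (C * heat f b x)
  refine (integral_mono (tH.mul tW).integrable ((i1.add i2).add i3) hpt).trans ?_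
  rw [integral_add' (i1.add i2) i3, integral_add' i1 i2, integral_const_mul, integral_const_mul,
    integral_const_mul, htr, integral_sub' tH.integrable (tρ.integrable.const_mul _),
    integral_const_mul, hρ1, hH, mul_one, sub_self, mul_zero, add_zero, mul_add]
  have est' := mul_le_mul_of_nonneg_left est (mul_nonneg hC hb0.le)
  have e1 : C * heat f b x * (heat f c x / heat f b x * (D * a ^ 3))
      = heat f c x * (C * D * a ^ 3) := by field_simp
  rw [e1] at est'
  refine add_le_add le_rfl (le_trans (le_of_eq ?_) est')
  simp only [cameronMartin, inner_smul_right, real_inner_smul_left]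

end IsLipPotential

end Recursion

section Main

variable {n : ℕ}

local notation "E" => EuclideanSpace ℝ (Fin n)

variable {f w : EuclideanSpace ℝ (Fin n) → ℝ}
  {g : EuclideanSpace ℝ (Fin n) → EuclideanSpace ℝ (Fin n)} {C : ℝ}

namespace IsLipPotential

lemma expBounded_exp_mul (hf : IsLipPotential f g C) :
    ExpBounded fun z => Real.exp (f z) * (⟪z, g z⟫ - 2 * f z) :=
  hf.expBounded_exp.mul ((ExpBounded.id'.inner hf.expBounded_grad).sub
    ((ExpBounded.const 2).mul hf.expBounded))

/-- One step of the Gaussian evolution increases the error by a higher order term. -/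
lemma heatBound_step (hf : IsLipPotential f g C) (hw : ∀ a b, |w a - w b| ≤ C * ‖a - b‖)
    {a b c D ε : ℝ} (h : a ^ 2 + b ^ 2 = c ^ 2)
    (hD : ∀ x e, ∫ y, heat f b (x + a • y)
        * gaussAvg w b (e + (a • y - a ^ 2 • heatDrift f g c x)) ∂(stdGaussian n)
        ≤ heat f c x * (gaussAvg w c e + D * a ^ 3))
    (hb : HeatBound f g w b ε) : HeatBound f g w c (ε + D * a ^ 3) := by
  intro x d
  have tw := ExpBounded.of_abs_sub_le hf.nonneg hw
  have tH := (hf.expBounded_heat b).comp_affine x a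
  have tN := (hf.expBounded_heatGrad b).comp_affine x a
  have tΦ := (hf.expBounded_exp_mul.gaussAvg b).comp_affine x a
  have hH : ∫ y, heat f b (x + a • y) ∂(stdGaussian n) = heat f c x :=
    gaussAvg_gaussAvg hf.expBounded_exp h x
  have hN : ∫ y, heatGrad f g b (x + a • y) ∂(stdGaussian n) = heatGrad f g c x :=
    gaussAvg_gaussAvg hf.expBounded_exp_smul_grad h x
  have hΦ := gaussAvg_gaussAvg hf.expBounded_exp_mul h x
  have hent := hf.heat_mul_log_add_le h x
  have hNv := hf.heat_smul_heatDrift c x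
  have hDx := hD x (x + d)
  generalize heatDrift f g c x = v at hent hNv hDx
  have tL : ExpBounded fun y => heat f b (x + a • y) * Real.log (heat f b (x + a • y)) :=
    tH.mul_log fun y => hf.heat_pos b _
  have tW : ExpBounded fun y => gaussAvg w b (x + d + (a • y - a ^ 2 • v)) := by
    have := (tw.gaussAvg b).comp_affine (x + d - a ^ 2 • v) a
    refine cast ?_ this
    congr 1; funext y; congr 1; abel
  have hpt : ∀ y, ⟪d - a ^ 2 • v, heatGrad f g b (x + a • y)⟫
      + gaussAvg (fun z => Real.exp (f z) * (⟪z, g z⟫ - 2 * f z)) b (x + a • y)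
      + 2 * (heat f b (x + a • y) * Real.log (heat f b (x + a • y)))
      ≤ heat f b (x + a • y) * gaussAvg w b (x + d + (a • y - a ^ 2 • v))
        + heat f b (x + a • y) * ε := fun y => by
    have := hb (x + a • y) (d - a ^ 2 • v)
    rw [mul_add] at this
    convert this using 4
    abel
  have tI : ExpBounded fun y => ⟪d - a ^ 2 • v, heatGrad f g b (x + a • y)⟫ :=
    (ExpBounded.const _).inner tN
  have key := integral_mono ((tI.add tΦ).add ((ExpBounded.const 2).mul tL)).integrable
    ((tH.mul tW).add (tH.mul (.const ε))).integrable hpt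
  rw [integral_add (tI.add tΦ).integrable ((ExpBounded.const 2).mul tL).integrable,
    integral_add tI.integrable tΦ.integrable, integral_inner tN.integrable, hN, hΦ,
    integral_const_mul, integral_add (tH.mul tW).integrable (tH.mul (.const ε)).integrable,
    integral_mul_const, hH] at key
  have hi : ⟪d - a ^ 2 • v, heatGrad f g c x⟫
      = ⟪d, heatGrad f g c x⟫ - a ^ 2 * heat f c x * ‖v‖ ^ 2 := by
    rw [inner_sub_left, real_inner_smul_left, ← hNv, real_inner_smul_right v,
      real_inner_self_eq_norm_sq]
    ring
  linarith

/-- The estimate at small scales. -/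
lemma exists_heatBound_base (hf : IsLipPotential f g C) (hw : ∀ a b, |w a - w b| ≤ C * ‖a - b‖)
    (hgw : ∀ b x, ⟪b, g x⟫ ≤ w b) :
    ∃ B, ∀ β, 0 < β → β ≤ 1 → HeatBound f g w β (B * β) := by
  have hC := hf.nonneg
  have tn : ExpBounded fun y : E => ‖y‖ := ExpBounded.id'.norm
  refine ⟨C * ((∫ y : E, Real.exp (C * ‖y‖) * ‖y‖ ∂(stdGaussian n))
      / ∫ y : E, Real.exp (-(C * ‖y‖)) ∂(stdGaussian n)) + C * ∫ y : E, ‖y‖ ∂(stdGaussian n),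
    fun β hβ hβ1 x d => ?_⟩
  have hh := hf.heat_pos β x
  have tw := ExpBounded.of_abs_sub_le hC hw
  have tE := hf.expBounded_exp.comp_affine x β
  have tN := hf.expBounded_exp_smul_grad.comp_affine x β
  have tΦ := hf.expBounded_exp_mul.comp_affine x β
  have tl : ExpBounded fun y => Real.exp (f (x + β • y)) * f (x + β • y) :=
    tE.mul (hf.expBounded.comp_affine x β)
  have hP := hf.integral_exp_mul_le hβ.le hβ1 tn (fun y => norm_nonneg y) x
  generalize (∫ y : E, Real.exp (C * ‖y‖) * ‖y‖ ∂(stdGaussian n))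
      / (∫ y : E, Real.exp (-(C * ‖y‖)) ∂(stdGaussian n)) = P at hP ⊢
  have hwβ : ∀ y, w (x + d + β • y) ≤ w (x + d) + C * β * ‖y‖ := fun y => by
    have := (le_abs_self _).trans (hw (x + d + β • y) (x + d))
    rw [add_sub_cancel_left, norm_smul, Real.norm_of_nonneg hβ.le] at this
    linarith
  have hW : w (x + d) ≤ gaussAvg w β (x + d) + C * β * ∫ y : E, ‖y‖ ∂(stdGaussian n) := by
    have h1 : ∀ y, w (x + d) ≤ w (x + d + β • y) + C * β * ‖y‖ := fun y => by
      have := (neg_le_abs _).trans (hw (x + d + β • y) (x + d))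
      rw [add_sub_cancel_left, norm_smul, Real.norm_of_nonneg hβ.le] at this
      linarith
    have := integral_mono (integrable_const (μ := stdGaussian n) (w (x + d)))
      ((tw.comp_affine (x + d) β).add ((ExpBounded.const (C * β)).mul tn)).integrable h1
    rw [integral_add (tw.comp_affine (x + d) β).integrable (tn.integrable.const_mul _),
      integral_const_mul] at this
    simpa [gaussAvg] using this
  have hlog : heat f β x * Real.log (heat f β x)
      ≤ ∫ y, Real.exp (f (x + β • y)) * f (x + β • y) ∂(stdGaussian n) := by
    have h1 : ∀ y, Real.exp (f (x + β • y)) * (Real.log (heat f β x) + 1) - heat f β x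
        ≤ Real.exp (f (x + β • y)) * f (x + β • y) := fun y => by
      have := mul_log_add_sub_le (Real.exp_pos (f (x + β • y))) hh
      rw [Real.log_exp] at this
      linarith
    have := integral_mono ((tE.mul (.const _)).sub (.const _)).integrable tl.integrable h1
    rw [integral_sub (tE.mul (.const _)).integrable (ExpBounded.const _).integrable,
      integral_mul_const] at this
    change heat f β x * _ - _ ≤ _ at this
    simp only [integral_const, probReal_univ, one_smul] at this
    linarith
  have hpt : ∀ y, ⟪d, Real.exp (f (x + β • y)) • g (x + β • y)⟫
      + Real.exp (f (x + β • y)) * (⟪x + β • y, g (x + β • y)⟫ - 2 * f (x + β • y))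
      ≤ Real.exp (f (x + β • y)) * w (x + d) + C * β * (Real.exp (f (x + β • y)) * ‖y‖)
        + -2 * (Real.exp (f (x + β • y)) * f (x + β • y)) := fun y => by
    have h1 := (hgw (x + d + β • y) (x + β • y)).trans (hwβ y)
    rw [show x + d + β • y = d + (x + β • y) by abel, inner_add_left] at h1
    have h2 := mul_le_mul_of_nonneg_left h1 (Real.exp_pos (f (x + β • y))).le
    rw [real_inner_smul_right]
    linarith
  have tI : ExpBounded fun y => ⟪d, Real.exp (f (x + β • y)) • g (x + β • y)⟫ :=
    (ExpBounded.const _).inner tN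
  have i1 := (tE.mul (.const (w (x + d)))).integrable
  have i2 := ((ExpBounded.const (C * β)).mul (tE.mul tn)).integrable
  have i3 := ((ExpBounded.const (-2)).mul tl).integrable
  have key := integral_mono (tI.add tΦ).integrable ((i1.add i2).add i3) hpt
  rw [integral_add tI.integrable tΦ.integrable, integral_inner tN.integrable,
    integral_add' (i1.add i2) i3, integral_add' i1 i2, integral_mul_const, integral_const_mul,
    integral_const_mul] at key
  change ⟪d, heatGrad f g β x⟫ + gaussAvg (fun z => Real.exp (f z) * (⟪z, g z⟫ - 2 * f z)) β x
    ≤ heat f β x * _ + _ + _ at key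
  have hP' := mul_le_mul_of_nonneg_left hP (mul_nonneg hC hβ.le)
  have hW' := mul_le_mul_of_nonneg_left hW hh.le
  linarith

lemma heatBound_one (hf : IsLipPotential f g C) (hw : ∀ a b, |w a - w b| ≤ C * ‖a - b‖)
    {β ε : ℝ} (hβ : 0 < β) (hβ1 : β < 1) (hε : HeatBound f g w β ε) {δ : ℝ} (hδ : 0 < δ) :
    HeatBound f g w 1 (ε + δ) := by
  obtain ⟨D, hD, hD'⟩ := exists_integral_heat_mul_le n hβ hf.nonneg
  obtain ⟨N, hN⟩ := exists_nat_gt ((D / δ) ^ 2)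
  have hN0 : (0 : ℝ) < N := lt_of_le_of_lt (sq_nonneg _) hN
  have hβ2 : β ^ 2 < 1 := pow_lt_one₀ hβ.le hβ1 two_ne_zero
  obtain ⟨a, ha⟩ : ∃ a, a = √((1 - β ^ 2) / N) := ⟨_, rfl⟩
  have hN1 : (1 : ℝ) ≤ N := by exact_mod_cast hN0
  have ha0 : 0 < a := ha ▸ Real.sqrt_pos.2 (div_pos (by linarith) hN0)
  have ha2 : a ^ 2 = (1 - β ^ 2) / N := by
    rw [ha, Real.sq_sqrt (div_nonneg (by linarith) hN0.le)]
  have haN : N * a ^ 2 = 1 - β ^ 2 := by rw [ha2]; field_simp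
  have ha1 : a ≤ 1 := by
    rw [← sq_le_one_iff₀ ha0.le]
    nlinarith [sq_nonneg β, sq_nonneg a]
  have main : ∀ k : ℕ, k ≤ N →
      HeatBound f g w √(β ^ 2 + k * a ^ 2) (ε + k * (D * a ^ 3)) := fun k => by
    induction k with
    | zero => intro _; simpa [Real.sqrt_sq hβ.le] using hε
    | succ k ih =>
      intro hk
      have hk' : (k : ℝ) + 1 ≤ N := by exact_mod_cast hk
      have h1 : 0 ≤ β ^ 2 + k * a ^ 2 := by positivity
      have h2 : (0 : ℝ) ≤ β ^ 2 + (k + 1 : ℕ) * a ^ 2 := by positivity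
      have hs : a ^ 2 + √(β ^ 2 + k * a ^ 2) ^ 2 = √(β ^ 2 + (k + 1 : ℕ) * a ^ 2) ^ 2 := by
        rw [Real.sq_sqrt h1, Real.sq_sqrt h2]; push_cast; ring
      have hlo : β ≤ √(β ^ 2 + k * a ^ 2) := Real.le_sqrt_of_sq_le (by
        have : 0 ≤ k * a ^ 2 := by positivity
        linarith)
      have hhi : √(β ^ 2 + k * a ^ 2) ≤ 1 := Real.sqrt_le_one.2 (by
        have : (k + 1) * a ^ 2 ≤ N * a ^ 2 := by gcongr
        nlinarith [sq_nonneg a])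
      have := hf.heatBound_step hw hs (hD' f w g hf hw a _ _ ha0 ha1 hlo hhi hs) (ih (by omega))
      convert this using 1
      push_cast; ring
  have h1 := main N le_rfl
  rw [haN, add_sub_cancel, Real.sqrt_one] at h1
  have herr : N * (D * a ^ 3) ≤ δ := by
    have e : N * (D * a ^ 3) = (1 - β ^ 2) * (D * a) := by rw [← haN]; ring
    have h2 : D * a ≤ δ := by
      refine le_of_sq_le_sq ?_ hδ.le
      rw [div_pow, div_lt_iff₀ (by positivity)] at hN
      have : a ^ 2 * N ≤ 1 := by rw [mul_comm, haN]; nlinarith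
      rw [mul_pow]
      nlinarith [sq_nonneg a, mul_le_mul_of_nonneg_left hN.le (sq_nonneg a)]
    rw [e]
    nlinarith [mul_nonneg hD ha0.le, sq_nonneg β]
  intro x d
  refine (h1 x d).trans ?_
  have := hf.heat_pos 1 x
  gcongr

/-- The radial derivative of a potential with bounded gradient is controlled by twice the
entropy plus the Gaussian average of a Lipschitz majorant of the support function. -/
theorem integral_exp_mul_inner_le (hf : IsLipPotential f g C)
    (hw : ∀ a b, |w a - w b| ≤ C * ‖a - b‖) (hgw : ∀ b x, ⟪b, g x⟫ ≤ w b)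
    (h1 : ∫ x, Real.exp (f x) ∂(stdGaussian n) = 1) :
    ∫ x, Real.exp (f x) * ⟪x, g x⟫ ∂(stdGaussian n)
      ≤ 2 * ∫ x, Real.exp (f x) * f x ∂(stdGaussian n) + ∫ x, w x ∂(stdGaussian n) := by
  obtain ⟨B, hB⟩ := hf.exists_heatBound_base hw hgw
  have hone : ∀ F : E → ℝ, gaussAvg F 1 0 = ∫ x, F x ∂(stdGaussian n) := fun F => by
    simp [gaussAvg]
  have hh : heat f 1 0 = 1 := by rw [heat, hone, h1]
  have key : ∀ β, 0 < β → β < 1 →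
      gaussAvg (fun z => Real.exp (f z) * (⟪z, g z⟫ - 2 * f z)) 1 0
        ≤ ∫ x, w x ∂(stdGaussian n) + (B * β + β) := fun β hβ hβ1 => by
    have := hf.heatBound_one hw hβ hβ1 (hB β hβ hβ1.le) hβ 0 0
    simpa [hh, hone w] using this
  have hlim : Filter.Tendsto (fun β : ℝ => ∫ x, w x ∂(stdGaussian n) + (B * β + β))
      (nhdsWithin 0 (Set.Ioi 0)) (nhds (∫ x, w x ∂(stdGaussian n))) := by
    refine tendsto_nhdsWithin_of_tendsto_nhds ?_
    have : Continuous fun β : ℝ => ∫ x, w x ∂(stdGaussian n) + (B * β + β) := by fun_prop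
    simpa using this.tendsto 0
  have hfin := ge_of_tendsto hlim (by
    filter_upwards [Ioo_mem_nhdsGT (zero_lt_one (α := ℝ))] with β hβ using key β hβ.1 hβ.2)
  rw [hone] at hfin
  have hs : ∫ x, Real.exp (f x) * (⟪x, g x⟫ - 2 * f x) ∂(stdGaussian n)
      = ∫ x, Real.exp (f x) * ⟪x, g x⟫ ∂(stdGaussian n)
        - 2 * ∫ x, Real.exp (f x) * f x ∂(stdGaussian n) := by
    rw [← integral_const_mul, ← integral_sub
      (hf.expBounded_exp.mul (ExpBounded.id'.inner hf.expBounded_grad)).integrable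
      ((hf.expBounded_exp.mul hf.expBounded).integrable.const_mul 2)]
    congr 1
    funext x
    ring
  linarith

/-- Gaussian integration by parts for the squared norm. -/
lemma integral_exp_mul_sq_norm (hf : IsLipPotential f g C) :
    ∫ x, Real.exp (f x) * ‖x‖ ^ 2 ∂(stdGaussian n)
      = n * ∫ x, Real.exp (f x) ∂(stdGaussian n)
        + ∫ x, Real.exp (f x) * ⟪x, g x⟫ ∂(stdGaussian n) := by
  have hcoord : ∀ i : Fin n, ∫ x : E, x i * (x i * Real.exp (f x)) ∂(stdGaussian n)
      = ∫ x, Real.exp (f x) ∂(stdGaussian n)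
        + ∫ x, Real.exp (f x) * (x i * g x i) ∂(stdGaussian n) := fun i => by
    obtain ⟨u, hu⟩ : ∃ u : E, u = EuclideanSpace.single i 1 := ⟨_, rfl⟩
    have hi : ∀ x : E, ⟪x, u⟫ = x i := fun x => by
      rw [hu, EuclideanSpace.inner_single_right]; simp
    have hd : ∀ x, HasFDerivAt (fun x : E => ⟪u, x⟫ * Real.exp (f x))
        (⟪u, x⟫ • (Real.exp (f x) • InnerProductSpace.toDual ℝ E (g x))
          + Real.exp (f x) • innerSL ℝ u) x := fun x =>
      (innerSL ℝ u).hasFDerivAt.mul (hf.hasGradientAt x).hasFDerivAt.exp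
    have hd' : ∀ x, fderiv ℝ (fun x : E => ⟪u, x⟫ * Real.exp (f x)) x u
        = Real.exp (f x) + Real.exp (f x) * (⟪x, u⟫ * ⟪g x, u⟫) := fun x => by
      rw [(hd x).fderiv]
      have h1 : ‖u‖ = 1 := by simp [hu]
      have h2 : ⟪u, x⟫ = ⟪x, u⟫ := real_inner_comm _ _
      simp [h1, h2]
      ring
    have tu : ExpBounded fun x : E => ⟪x, u⟫ := ExpBounded.id'.inner (.const u)
    have t2 := hf.expBounded_exp.mul (tu.mul (hf.expBounded_grad.inner (.const u)))
    have := integral_inner_mul_stdGaussian (fun x => (hd x).differentiableAt)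
      (((ExpBounded.const u).inner ExpBounded.id').mul hf.expBounded_exp) u
      (by simpa only [hd'] using hf.expBounded_exp.add t2)
    simp only [hd'] at this
    rw [integral_add hf.expBounded_exp.integrable t2.integrable] at this
    simpa only [real_inner_comm _ u, hi] using this
  have tx : ∀ i : Fin n, ExpBounded fun x : E => x i := fun i =>
    ExpBounded.clm (EuclideanSpace.proj i : E →L[ℝ] ℝ)
  have tg : ∀ i : Fin n, ExpBounded fun x : E => g x i := fun i =>
    hf.expBounded_grad.of_norm_le ((EuclideanSpace.proj i : E →L[ℝ] ℝ).continuous.comp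
      hf.continuous_grad).stronglyMeasurable fun x => PiLp.norm_apply_le _ _
  have e1 : ∀ x : E, Real.exp (f x) * ‖x‖ ^ 2 = ∑ i, x i * (x i * Real.exp (f x)) := fun x => by
    rw [EuclideanSpace.norm_sq_eq, Finset.mul_sum]
    refine Finset.sum_congr rfl fun i _ => ?_
    rw [Real.norm_eq_abs, sq_abs]; ring
  have e2 : ∀ x : E, Real.exp (f x) * ⟪x, g x⟫ = ∑ i, Real.exp (f x) * (x i * g x i) :=
    fun x => by
      rw [PiLp.inner_apply, Finset.mul_sum]
      refine Finset.sum_congr rfl fun i _ => ?_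
      simp [mul_comm]
  simp only [e1, e2]
  rw [integral_finsetSum _ fun i _ => ((tx i).mul ((tx i).mul hf.expBounded_exp)).integrable,
    integral_finsetSum _ fun i _ => (hf.expBounded_exp.mul ((tx i).mul (tg i))).integrable,
    Finset.sum_congr rfl fun i _ => hcoord i, Finset.sum_add_distrib]
  simp

end IsLipPotential

end Main

section GaussWidth

variable {n : ℕ} {K : Set (EuclideanSpace ℝ (Fin n))} {C : ℝ}

lemma exists_norm_le_of_bddAbove_inner
    (hK : ∀ y : EuclideanSpace ℝ (Fin n),
      BddAbove (Set.range fun t : K => ⟪y, (t : EuclideanSpace ℝ (Fin n))⟫)) :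
    ∃ C, ∀ t ∈ K, ‖t‖ ≤ C := by
  obtain ⟨C, hC⟩ := banach_steinhaus (𝕜 := ℝ) (𝕜₂ := ℝ)
    (g := fun t : K => innerSL ℝ (t : EuclideanSpace ℝ (Fin n))) (fun y => by
      obtain ⟨a, ha⟩ := hK y
      obtain ⟨b, hb⟩ := hK (-y)
      refine ⟨max a b, fun t => ?_⟩
      have h1 := ha (Set.mem_range_self t)
      have h2 := hb (Set.mem_range_self t)
      beta_reduce at h1 h2
      rw [inner_neg_left] at h2
      rw [innerSL_apply_apply, real_inner_comm, Real.norm_eq_abs]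
      exact abs_le.2 ⟨by linarith [le_max_right a b], h1.trans (le_max_left a b)⟩)
  exact ⟨C, fun t ht => by simpa using hC ⟨t, ht⟩⟩

lemma inner_le_gaussWidthFn (hK : ∀ t ∈ K, ‖t‖ ≤ C) {t : EuclideanSpace ℝ (Fin n)}
    (ht : t ∈ K) (y : EuclideanSpace ℝ (Fin n)) : ⟪y, t⟫ ≤ gaussWidthFn K y := by
  refine le_ciSup (f := fun t : K => ⟪y, (t : EuclideanSpace ℝ (Fin n))⟫) ⟨‖y‖ * C, ?_⟩ ⟨t, ht⟩
  rintro _ ⟨s, rfl⟩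
  exact (real_inner_le_norm _ _).trans (by gcongr; exact hK s s.2)

lemma abs_gaussWidthFn_sub_le (hK : ∀ t ∈ K, ‖t‖ ≤ C) (hne : K.Nonempty)
    (a b : EuclideanSpace ℝ (Fin n)) :
    |gaussWidthFn K a - gaussWidthFn K b| ≤ C * ‖a - b‖ := by
  have : Nonempty K := hne.to_subtype
  have key : ∀ a b : EuclideanSpace ℝ (Fin n),
      gaussWidthFn K a ≤ gaussWidthFn K b + C * ‖a - b‖ := fun a b => by
    refine ciSup_le fun t => ?_
    have h1 := inner_le_gaussWidthFn hK t.2 b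
    have h2 : ⟪a - b, (t : EuclideanSpace ℝ (Fin n))⟫ ≤ ‖a - b‖ * C :=
      (real_inner_le_norm _ _).trans (by gcongr; exact hK t t.2)
    rw [inner_sub_left] at h2
    linarith
  have h1 := key a b
  have h2 := key b a
  rw [norm_sub_rev] at h2
  exact abs_sub_le_iff.2 ⟨by linarith, by linarith⟩

end GaussWidth

theorem second_moment_entropy_bound (n : ℕ)
    (f : EuclideanSpace ℝ (Fin n) → ℝ) (ν : Measure (EuclideanSpace ℝ (Fin n)))
    (hf : ContDiff ℝ 2 f)
    (hν : ν = (stdGaussian n).withDensity fun x => ENNReal.ofReal (Real.exp (f x)))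
    (hprob : IsProbabilityMeasure ν)
    (hsec : Integrable (fun x => ‖x‖ ^ 2) ν)
    (hsecγ : Integrable (fun x => ‖x‖ ^ 2) (stdGaussian n))
    (hent : Integrable f ν)
    (hbdd : ∀ y : EuclideanSpace ℝ (Fin n),
      BddAbove (Set.range fun t : Set.range (gradient f) =>
        ⟪y, (t : EuclideanSpace ℝ (Fin n))⟫))
    (hD : Integrable (gaussWidthFn (Set.range (gradient f))) (stdGaussian n)) :
    ∫ x, ‖x‖ ^ 2 ∂ν - ∫ x, ‖x‖ ^ 2 ∂(stdGaussian n)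
      ≤ 2 * ∫ x, f x ∂ν
        + ∫ y, gaussWidthFn (Set.range (gradient f)) y ∂(stdGaussian n) := by
  have hgrad : ∀ x, HasGradientAt f (gradient f x) x := fun x =>
    (hf.differentiable two_ne_zero x).hasGradientAt
  have hcont : Continuous (gradient f) :=
    (InnerProductSpace.toDual ℝ (EuclideanSpace ℝ (Fin n))).symm.continuous.comp
      (hf.continuous_fderiv two_ne_zero)
  obtain ⟨C, hC⟩ := exists_norm_le_of_bddAbove_inner hbdd
  have hL : IsLipPotential f (gradient f) C := ⟨hgrad, hcont, fun x => hC _ ⟨x, rfl⟩⟩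
  have hL0 : IsLipPotential (fun _ : EuclideanSpace ℝ (Fin n) => (0 : ℝ)) (fun _ => 0) 0 :=
    ⟨fun x => hasGradientAt_const x 0, continuous_const, fun x => by simp⟩
  have hνint : ∀ F : EuclideanSpace ℝ (Fin n) → ℝ,
      ∫ x, F x ∂ν = ∫ x, Real.exp (f x) * F x ∂(stdGaussian n) := fun F => by
    rw [hν, integral_withDensity_eq_integral_toReal_smul
      hL.expBounded_exp.1.measurable.ennreal_ofReal
      (Filter.Eventually.of_forall fun _ => ENNReal.ofReal_lt_top)]
    simp only [ENNReal.toReal_ofReal (Real.exp_pos _).le, smul_eq_mul]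
  have hone : ∫ x, Real.exp (f x) ∂(stdGaussian n) = 1 := by
    have := hνint fun _ => 1
    simpa using this.symm
  have hγ := hL0.integral_exp_mul_sq_norm
  simp only [Real.exp_zero, one_mul, inner_zero_right, integral_zero, add_zero, integral_const,
    probReal_univ, smul_eq_mul, mul_one] at hγ
  have hwidth := hL.integral_exp_mul_inner_le (abs_gaussWidthFn_sub_le hC (Set.range_nonempty _))
    (fun y x => inner_le_gaussWidthFn hC ⟨x, rfl⟩ y) hone
  rw [hνint, hνint, hL.integral_exp_mul_sq_norm, hone, hγ, mul_one, add_sub_cancel_left]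
  exact hwidth
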